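/- arXiv:2507.17362 — 2 statements merged into one kernel-verified Lean document; each statement's English description precedes it below -/
import Mathlib

section
/- Full-or-empty dichotomy for cells: Fix n ≥ 1 and a complex number u with u^{n+1} = 1. Let C be a connected component (in the subspace topology) of (𝒯ₙ°)³ ∖ 𝒫ₙ,ᵤʳᵉᵈ. Then either C ⊆ 𝒫ₙ,ᵤ or C ∩ 𝒫ₙ,ᵤ = ∅. -/
open Real Matrix Set

noncomputable section

abbrev TriN (n : ℕ) : Type := (Fin n → ℝ) × (Fin n → ℝ) × (Fin n → ℝ)

/-- `α ∈ 𝒯ₙ = {α ∈ [0,2π)ⁿ : α₁ ≥ … ≥ αₙ}` (index `0` ↔ subscript 1). -/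
def memTn (n : ℕ) (α : Fin n → ℝ) : Prop :=
  (∀ i, 0 ≤ α i ∧ α i < 2 * π) ∧ ∀ i j : Fin n, i ≤ j → α j ≤ α i

def memTn3 (n : ℕ) (τ : TriN n) : Prop := memTn n τ.1 ∧ memTn n τ.2.1 ∧ memTn n τ.2.2

/-- `α ∈ 𝒯ₙ° = {α : 0 < αₙ < … < α₁ < 2π}`. -/
def memTnInt (n : ℕ) (α : Fin n → ℝ) : Prop :=
  (∀ i, 0 < α i ∧ α i < 2 * π) ∧ ∀ i j : Fin n, i < j → α j < α i

def memTnInt3 (n : ℕ) (τ : TriN n) : Prop :=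
  memTnInt n τ.1 ∧ memTnInt n τ.2.1 ∧ memTnInt n τ.2.2

abbrev MatN (n : ℕ) : Type := Matrix (Fin (n + 1)) (Fin (n + 1)) ℂ

/-- The form Jₙ = diag(1,…,1,−1). -/
def Jn (n : ℕ) : MatN n := Matrix.diagonal (fun i => if (i : ℕ) = n then -1 else 1)

/-- Membership in U(n,1). -/
def memUn (n : ℕ) (M : MatN n) : Prop := Mᴴ * Jn n * M = Jn n

/-- The diagonal matrix E(α) = diag(e^{iα₁}, …, e^{iαₙ}, 1). -/
def En (n : ℕ) (α : Fin n → ℝ) : MatN n :=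
  Matrix.diagonal (fun i =>
    if h : (i : ℕ) < n then Complex.exp ((α ⟨i.1, h⟩ : ℝ) * Complex.I) else 1)

/-- `M` is of elliptic type `α`: conjugate in U(n,1) to E(α). -/
def ellTypeN (n : ℕ) (M : MatN n) (α : Fin n → ℝ) : Prop :=
  ∃ P : MatN n, memUn n P ∧ M = P * En n α * P⁻¹

/-- The standard lift Lₙ(α) ∈ SU(n,1):
diag(e^{i(nα₁−(α₂+⋯+αₙ))/(n+1)}, …, e^{i(nαₙ−(α₁+⋯+α_{n−1}))/(n+1)}, e^{−i(α₁+⋯+αₙ)/(n+1)}). -/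
def Ln (n : ℕ) (α : Fin n → ℝ) : MatN n :=
  Matrix.diagonal (fun i =>
    if h : (i : ℕ) < n then
      Complex.exp (((((n : ℝ) * α ⟨i.1, h⟩ - ((∑ l, α l) - α ⟨i.1, h⟩)) / ((n : ℝ) + 1)) : ℝ)
        * Complex.I)
    else Complex.exp (((-(∑ l, α l) / ((n : ℝ) + 1)) : ℝ) * Complex.I))

/-- `𝒫ₙ,ᵤ`: solution set with standard lifts multiplying to `u·I`. -/
def PsolN (n : ℕ) (u : ℂ) : Set (TriN n) := {τ | memTn3 n τ ∧ ∃ A B C : MatN n,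
  memUn n A ∧ memUn n B ∧ memUn n C ∧
  (∃ P : MatN n, memUn n P ∧ A = P * Ln n τ.1 * P⁻¹) ∧
  (∃ P : MatN n, memUn n P ∧ B = P * Ln n τ.2.1 * P⁻¹) ∧
  (∃ P : MatN n, memUn n P ∧ C = P * Ln n τ.2.2 * P⁻¹) ∧
  A * B * C = u • (1 : MatN n)}

/-- `𝒫ₙ,ᵤʳᵉᵈ`: the subset where `A`, `B`, `C` can moreover be chosen with a common
nontrivial invariant subspace. -/
def PsolRedN (n : ℕ) (u : ℂ) : Set (TriN n) := {τ | memTn3 n τ ∧ ∃ A B C : MatN n,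
  memUn n A ∧ memUn n B ∧ memUn n C ∧
  (∃ P : MatN n, memUn n P ∧ A = P * Ln n τ.1 * P⁻¹) ∧
  (∃ P : MatN n, memUn n P ∧ B = P * Ln n τ.2.1 * P⁻¹) ∧
  (∃ P : MatN n, memUn n P ∧ C = P * Ln n τ.2.2 * P⁻¹) ∧
  A * B * C = u • (1 : MatN n) ∧
  ∃ W : Submodule ℂ (Fin (n + 1) → ℂ), W ≠ ⊥ ∧ W ≠ ⊤ ∧
    (∀ w ∈ W, A.mulVec w ∈ W) ∧ (∀ w ∈ W, B.mulVec w ∈ W) ∧ (∀ w ∈ W, C.mulVec w ∈ W)}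


/-- Diagonal entries of `Ln`. -/
def lam (n : ℕ) (α : Fin n → ℝ) (i : Fin (n + 1)) : ℂ :=
    if h : (i : ℕ) < n then
      Complex.exp (((((n : ℝ) * α ⟨i.1, h⟩ - ((∑ l, α l) - α ⟨i.1, h⟩)) / ((n : ℝ) + 1)) : ℝ)
        * Complex.I)
    else Complex.exp (((-(∑ l, α l) / ((n : ℝ) + 1)) : ℝ) * Complex.I)

lemma Ln_eq (n : ℕ) (α : Fin n → ℝ) : Ln n α = Matrix.diagonal (lam n α) := rfl

lemma lam_last (n : ℕ) (α : Fin n → ℝ) :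
    lam n α (Fin.last n) = Complex.exp (((-(∑ l, α l) / ((n : ℝ) + 1)) : ℝ) * Complex.I) := by
  simp [lam]

lemma lam_cast (n : ℕ) (α : Fin n → ℝ) (i : Fin n) :
    lam n α i.castSucc = lam n α (Fin.last n) * Complex.exp ((α i : ℝ) * Complex.I) := by
  rw [lam_last, ← Complex.exp_add]
  simp only [lam, Fin.val_castSucc, Fin.is_lt, dite_true, Fin.eta]
  congr 1
  rw [← add_mul, ← Complex.ofReal_add]
  congr 2
  have : (n : ℝ) + 1 ≠ 0 := by positivity
  field_simp
  ring

lemma lam_norm (n : ℕ) (α : Fin n → ℝ) (i) : ‖lam n α i‖ = 1 := by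
  unfold lam; split_ifs <;> exact Complex.norm_exp_ofReal_mul_I _

lemma lam_ne (n : ℕ) (α : Fin n → ℝ) (i) : lam n α i ≠ 0 := by
  rw [← norm_ne_zero_iff, lam_norm]; norm_num

lemma lam_prod (n : ℕ) (α : Fin n → ℝ) : ∏ i, lam n α i = 1 := by
  rw [Fin.prod_univ_castSucc]
  simp only [lam_cast, Finset.prod_mul_distrib, Finset.prod_const, Finset.card_univ, Fintype.card_fin]
  rw [mul_right_comm, ← pow_succ, lam_last, ← Complex.exp_nat_mul, ← Complex.exp_sum,
    ← Complex.exp_add, ← Finset.sum_mul, ← mul_assoc, ← add_mul]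
  convert Complex.exp_zero using 2
  have : (n : ℂ) + 1 ≠ 0 := by exact_mod_cast Nat.succ_ne_zero n
  push_cast
  field_simp
  ring

lemma lam_contDiff (n : ℕ) (i) : ContDiff ℝ 1 (fun α : Fin n → ℝ => lam n α i) := by
  unfold lam
  have h0 : ContDiff ℝ 1 (fun x : ℝ => (x : ℂ)) := Complex.ofRealCLM.contDiff
  split_ifs
  · apply ContDiff.cexp
    apply ContDiff.mul _ contDiff_const
    apply h0.comp
    fun_prop
  · apply ContDiff.cexp
    apply ContDiff.mul _ contDiff_const
    apply h0.comp
    fun_prop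

lemma lam_cont (n : ℕ) (i) : Continuous (fun α : Fin n → ℝ => lam n α i) :=
  (lam_contDiff n i).continuous

lemma Ln_cont (n : ℕ) : Continuous (Ln n) := by
  apply Continuous.matrix_diagonal
  exact continuous_pi (lam_cont n)

lemma Ln_det (n : ℕ) (α : Fin n → ℝ) : (Ln n α).det = 1 := by
  rw [Ln_eq, det_diagonal, lam_prod]

def epsn (n : ℕ) (i : Fin (n + 1)) : ℂ := if (i : ℕ) = n then -1 else 1

lemma epsn_last (n : ℕ) : epsn n (Fin.last n) = -1 := by simp [epsn]
lemma epsn_cast (n : ℕ) (i : Fin n) : epsn n i.castSucc = 1 := by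
  simp [epsn, i.2.ne]

lemma Jn_eq (n : ℕ) : Jn n = Matrix.diagonal (epsn n) := rfl

lemma Jn_sq (n : ℕ) : Jn n * Jn n = 1 := by
  rw [Jn_eq, diagonal_mul_diagonal, ← diagonal_one]
  congr 1; ext i; simp only [epsn]; split_ifs <;> simp

lemma Jn_star (n : ℕ) : (Jn n)ᴴ = Jn n := by
  rw [Jn_eq, diagonal_conjTranspose]
  congr 1; ext i; simp only [epsn, Pi.star_apply]; split_ifs <;> simp

lemma memUn_left {n : ℕ} {g : MatN n} (h : memUn n g) : Jn n * gᴴ * Jn n * g = 1 := by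
  have : Jn n * (gᴴ * Jn n * g) = 1 := by rw [h, Jn_sq]
  simpa only [Matrix.mul_assoc] using this

lemma memUn_right {n : ℕ} {g : MatN n} (h : memUn n g) : g * (Jn n * gᴴ * Jn n) = 1 :=
  mul_eq_one_comm.mp (memUn_left h)

lemma memUn_inv {n : ℕ} {g : MatN n} (h : memUn n g) : g⁻¹ = Jn n * gᴴ * Jn n :=
  Matrix.inv_eq_left_inv (memUn_left h)

lemma memUn_mul_inv {n : ℕ} {g : MatN n} (h : memUn n g) : g * g⁻¹ = 1 := by
  rw [memUn_inv h, memUn_right h]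

lemma memUn_inv_mul {n : ℕ} {g : MatN n} (h : memUn n g) : g⁻¹ * g = 1 := by
  rw [memUn_inv h, memUn_left h]

lemma memUn_isUnit_det {n : ℕ} {g : MatN n} (h : memUn n g) : IsUnit g.det :=
  Matrix.isUnit_det_of_left_inverse (memUn_left h)

lemma memUn_right' {n : ℕ} {g : MatN n} (h : memUn n g) : g * Jn n * gᴴ = Jn n := by
  have : g * (Jn n * gᴴ * Jn n) * Jn n = Jn n := by rw [memUn_right h, one_mul]
  simpa only [Matrix.mul_assoc, Jn_sq, Matrix.mul_one] using this

lemma memUn_one (n : ℕ) : memUn n 1 := by simp [memUn]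

lemma memUn_mul {n : ℕ} {g h : MatN n} (hg : memUn n g) (hh : memUn n h) : memUn n (g * h) := by
  unfold memUn at *
  rw [conjTranspose_mul]
  calc hᴴ * gᴴ * Jn n * (g * h) = hᴴ * (gᴴ * Jn n * g) * h := by simp only [Matrix.mul_assoc]
    _ = _ := by rw [hg, hh]

lemma memUn_inv' {n : ℕ} {g : MatN n} (hg : memUn n g) : memUn n g⁻¹ := by
  rw [memUn_inv hg]
  unfold memUn
  simp only [conjTranspose_mul, conjTranspose_conjTranspose, Jn_star]
  calc Jn n * (g * Jn n) * Jn n * (Jn n * gᴴ * Jn n)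
      = Jn n * (g * (Jn n * (Jn n * Jn n) * gᴴ) * Jn n) := by simp only [Matrix.mul_assoc]
    _ = Jn n * ((g * Jn n * gᴴ) * Jn n) := by rw [Jn_sq]; simp only [Matrix.mul_assoc, Matrix.mul_one]
    _ = Jn n := by rw [memUn_right' hg, Jn_sq, Matrix.mul_one]

lemma memUn_Ln (n : ℕ) (α) : memUn n (Ln n α) := by
  unfold memUn
  rw [Ln_eq, Jn_eq, diagonal_conjTranspose, diagonal_mul_diagonal, diagonal_mul_diagonal]
  congr 1; ext i
  have : star (lam n α i) * lam n α i = 1 := by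
    have := Complex.conj_mul' (lam n α i)
    rw [lam_norm] at this
    simpa using this
  rw [Pi.star_apply, mul_right_comm, this, one_mul]

lemma memUn_smul {n : ℕ} {g : MatN n} (hg : memUn n g) {u : ℂ} (hu : ‖u‖ = 1) : memUn n (u • g) := by
  unfold memUn at *
  have : star u * u = 1 := by
    have := Complex.conj_mul' u
    rw [hu] at this
    simpa using this
  rw [conjTranspose_smul, Matrix.smul_mul, Matrix.smul_mul, Matrix.mul_smul, hg, smul_smul, this, one_smul]

lemma memUn_conj {n : ℕ} {g : MatN n} (hg : memUn n g) (α) : memUn n (g * Ln n α * g⁻¹) :=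
  memUn_mul (memUn_mul hg (memUn_Ln n α)) (memUn_inv' hg)

/-- entries of the relation `hᴴ J h = M`. -/
lemma entry_rel {n : ℕ} (h : MatN n) (j k) :
    (hᴴ * Jn n * h) j k = (∑ i : Fin n, star (h i.castSucc j) * h i.castSucc k)
      - star (h (Fin.last n) j) * h (Fin.last n) k := by
  rw [Jn_eq, Matrix.mul_apply, Fin.sum_univ_castSucc]
  simp [mul_diagonal, epsn_last, epsn_cast, conjTranspose_apply, sub_eq_add_neg]

lemma entry_rel' {n : ℕ} (h : MatN n) (j k) :
    (h * Jn n * hᴴ) j k = (∑ i : Fin n, h j i.castSucc * star (h k i.castSucc))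
      - h j (Fin.last n) * star (h k (Fin.last n)) := by
  rw [Jn_eq, Matrix.mul_apply, Fin.sum_univ_castSucc]
  simp [mul_diagonal, epsn_last, epsn_cast, conjTranspose_apply, sub_eq_add_neg]

lemma star_mul_nsq (z : ℂ) : star z * z = ((Complex.normSq z : ℝ) : ℂ) := by
  rw [Complex.normSq_eq_conj_mul_self]; rfl

/-- strict convexity -/
lemma factor_ne {n : ℕ} {α : Fin n → ℝ} (hα : memTnInt n α) (p : Fin (n+1) → ℝ)
    (hp : ∀ i, 0 ≤ p i) (hl : p (Fin.last n) ≠ 0)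
    (hs : ∑ i : Fin n, p i.castSucc = p (Fin.last n)) :
    ∑ i, epsn n i * lam n α i * (p i : ℂ) ≠ 0 := by
  intro h0
  rw [Fin.sum_univ_castSucc] at h0
  simp only [epsn_cast, epsn_last, lam_cast] at h0
  have h1 : lam n α (Fin.last n) * ((∑ i : Fin n, Complex.exp ((α i : ℝ) * Complex.I) * (p i.castSucc : ℂ)) - (p (Fin.last n) : ℂ)) = 0 := by
    rw [← h0, mul_sub, Finset.mul_sum, sub_eq_add_neg]
    congr 1
    · apply Finset.sum_congr rfl; intros; ring
    · ring
  have h2 := (mul_eq_zero.mp h1).resolve_left (lam_ne _ _ _)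
  have h3 := congrArg Complex.re h2
  simp only [Complex.sub_re, Complex.re_sum, Complex.re_mul_ofReal, Complex.exp_ofReal_mul_I_re, Complex.ofReal_re, Complex.zero_re] at h3
  rw [← hs, ← Finset.sum_sub_distrib] at h3
  have h4 : ∀ i ∈ Finset.univ, (Real.cos (α i) * p i.castSucc - p i.castSucc) ≤ 0 := by
    intro i _
    nlinarith [Real.cos_le_one (α i), hp i.castSucc]
  rw [Finset.sum_eq_zero_iff_of_nonpos h4] at h3
  apply hl
  rw [← hs]
  apply Finset.sum_eq_zero
  intro i _
  have h5 := h3 i (Finset.mem_univ i)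
  have h6 : Real.cos (α i) ≠ 1 := by
    intro h
    have := (Real.cos_eq_one_iff_of_lt_of_lt (by linarith [(hα.1 i).1, Real.pi_pos]) (hα.1 i).2).mp h
    exact (hα.1 i).1.ne' this
  have : (Real.cos (α i) - 1) * p i.castSucc = 0 := by linarith
  exact (mul_eq_zero.mp this).resolve_left (sub_ne_zero.mpr h6)

lemma rank_one {n : ℕ} (h : MatN n) (h1 : hᴴ * Jn n * h = 0) (i j) :
    h i j * h (Fin.last n) (Fin.last n) = h i (Fin.last n) * h (Fin.last n) j := by
  set w := h (Fin.last n) (Fin.last n) with hw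
  set z := h (Fin.last n) j with hz
  have e : ∀ a b, (∑ i : Fin n, star (h i.castSucc a) * h i.castSucc b) = star (h (Fin.last n) a) * h (Fin.last n) b := by
    intro a b
    have := congrFun (congrFun h1 a) b
    rw [entry_rel] at this
    simpa [sub_eq_zero] using this
  have key : ∑ i : Fin n, star (h i.castSucc j * w - h i.castSucc (Fin.last n) * z) * (h i.castSucc j * w - h i.castSucc (Fin.last n) * z) = 0 := by
    calc _ = star w * w * (∑ i : Fin n, star (h i.castSucc j) * h i.castSucc j)
          - star w * z * (∑ i : Fin n, star (h i.castSucc j) * h i.castSucc (Fin.last n))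
          - star z * w * (∑ i : Fin n, star (h i.castSucc (Fin.last n)) * h i.castSucc j)
          + star z * z * (∑ i : Fin n, star (h i.castSucc (Fin.last n)) * h i.castSucc (Fin.last n)) := by
            simp only [Finset.mul_sum, ← Finset.sum_sub_distrib, ← Finset.sum_add_distrib]
            apply Finset.sum_congr rfl; intro i _
            simp only [star_sub, star_mul']; ring
      _ = 0 := by
        simp only [e, ← hw, ← hz]; ring
  simp only [star_mul_nsq] at key
  rw [← Complex.ofReal_sum, Complex.ofReal_eq_zero, Finset.sum_eq_zero_iff_of_nonneg (fun _ _ => Complex.normSq_nonneg _)] at key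
  induction i using Fin.lastCases with
  | last => ring
  | cast i =>
    have := Complex.normSq_eq_zero.mp (key i (Finset.mem_univ i))
    exact sub_eq_zero.mp this

lemma trace_formula {n : ℕ} (a b : Fin (n+1) → ℂ) (h : MatN n) :
    (Matrix.diagonal a * h * Matrix.diagonal b * (Jn n * hᴴ * Jn n)).trace =
      ∑ i, ∑ j, epsn n i * a i * (epsn n j * b j) * ((Complex.normSq (h i j) : ℝ) : ℂ) := by
  simp only [Matrix.trace, Matrix.diag_apply, Jn_eq]
  apply Finset.sum_congr rfl; intro i _
  rw [Matrix.mul_apply]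
  apply Finset.sum_congr rfl; intro j _
  rw [mul_diagonal, diagonal_mul, mul_diagonal, diagonal_mul, conjTranspose_apply, ← star_mul_nsq]
  ring

lemma limit_trace_ne {n : ℕ} {α β : Fin n → ℝ} (hα : memTnInt n α) (hβ : memTnInt n β) (h : MatN n)
    (h1 : hᴴ * Jn n * h = 0) (h2 : h * Jn n * hᴴ = 0) (h3 : h (Fin.last n) (Fin.last n) ≠ 0) :
    (Ln n α * h * Ln n β * (Jn n * hᴴ * Jn n)).trace ≠ 0 := by
  intro h0
  rw [Ln_eq, Ln_eq, trace_formula] at h0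
  set w := h (Fin.last n) (Fin.last n) with hw
  have hne : Complex.normSq w ≠ 0 := by simpa using h3
  have f1 := factor_ne hα (fun i => Complex.normSq (h i (Fin.last n))) (fun _ => Complex.normSq_nonneg _) hne (by
    have := congrFun (congrFun h1 (Fin.last n)) (Fin.last n)
    rw [entry_rel, Matrix.zero_apply, sub_eq_zero] at this
    simp only [star_mul_nsq] at this
    exact_mod_cast this)
  have f2 := factor_ne hβ (fun i => Complex.normSq (h (Fin.last n) i)) (fun _ => Complex.normSq_nonneg _) hne (by
    have := congrFun (congrFun h2 (Fin.last n)) (Fin.last n)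
    rw [entry_rel', Matrix.zero_apply, sub_eq_zero] at this
    simp only [mul_comm _ (star _), star_mul_nsq] at this
    exact_mod_cast this)
  apply mul_ne_zero f1 f2
  rw [Finset.sum_mul_sum]
  rw [← mul_zero ((Complex.normSq w : ℝ) : ℂ), ← h0, Finset.mul_sum]
  apply Finset.sum_congr rfl; intro i _
  rw [Finset.mul_sum]
  apply Finset.sum_congr rfl; intro j _
  have := congrArg Complex.normSq (rank_one h h1 i j)
  rw [Complex.normSq_mul, Complex.normSq_mul] at this
  have t : ((Complex.normSq (h i j) : ℝ) : ℂ) * ((Complex.normSq w : ℝ) : ℂ) = ((Complex.normSq (h i (Fin.last n)) : ℝ) : ℂ) * ((Complex.normSq (h (Fin.last n) j) : ℝ) : ℂ) := by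
    exact_mod_cast this
  linear_combination -(epsn n i * lam n α i * (epsn n j * lam n β j)) * t

open Filter Topology in
lemma compact_seq {n : ℕ} (g : ℕ → MatN n) (R : ℝ) (hR : ∀ᶠ k in atTop, ∀ i j, ‖g k i j‖ ≤ R) :
    ∃ (G : MatN n) (φ : ℕ → ℕ), StrictMono φ ∧ Tendsto (fun k => g (φ k)) atTop (𝓝 G) := by
  have hc : IsCompact (Set.univ.pi (fun _ : Fin (n+1) => Set.univ.pi (fun _ : Fin (n+1) => Metric.closedBall (0:ℂ) R))) :=
    isCompact_univ_pi (fun _ => isCompact_univ_pi (fun _ => isCompact_closedBall _ _))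
  let g' : ℕ → Fin (n+1) → Fin (n+1) → ℂ := fun k i j => g k i j
  obtain ⟨G, -, φ, hφ, ht⟩ := hc.tendsto_subseq' (x := g') (by
    apply Eventually.frequently
    filter_upwards [hR] with k hk
    intro i _ j _
    simpa [g'] using hk i j)
  exact ⟨G, φ, hφ, ht⟩

lemma entry_bound {n : ℕ} {g : MatN n} (hg : memUn n g) (i j) :
    Complex.normSq (g i j) ≤ 1 + Complex.normSq (g (Fin.last n) (Fin.last n)) := by
  set w := g (Fin.last n) (Fin.last n) with hw
  have c : ∀ j : Fin n, ∑ i : Fin n, Complex.normSq (g i.castSucc j.castSucc) = 1 + Complex.normSq (g (Fin.last n) j.castSucc) := by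
    intro j
    have := congrFun (congrFun hg j.castSucc) j.castSucc
    rw [entry_rel, Jn_eq, diagonal_apply_eq, epsn_cast, sub_eq_iff_eq_add] at this
    simp only [star_mul_nsq] at this
    exact_mod_cast this
  have cl : ∑ i : Fin n, Complex.normSq (g i.castSucc (Fin.last n)) = -1 + Complex.normSq w := by
    have := congrFun (congrFun hg (Fin.last n)) (Fin.last n)
    rw [entry_rel, Jn_eq, diagonal_apply_eq, epsn_last, sub_eq_iff_eq_add] at this
    simp only [star_mul_nsq] at this
    exact_mod_cast this
  have rl : ∑ i : Fin n, Complex.normSq (g (Fin.last n) i.castSucc) = -1 + Complex.normSq w := by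
    have := congrFun (congrFun (memUn_right' hg) (Fin.last n)) (Fin.last n)
    rw [entry_rel', Jn_eq, diagonal_apply_eq, epsn_last, sub_eq_iff_eq_add] at this
    simp only [mul_comm _ (star _), star_mul_nsq] at this
    exact_mod_cast this
  have z : ∀ j : Fin n, Complex.normSq (g (Fin.last n) j.castSucc) ≤ -1 + Complex.normSq w := by
    intro j
    rw [← rl]
    exact Finset.single_le_sum (f := fun j : Fin n => Complex.normSq (g (Fin.last n) j.castSucc)) (fun _ _ => Complex.normSq_nonneg _) (Finset.mem_univ j)
  induction i using Fin.lastCases with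
  | last =>
    induction j using Fin.lastCases with
    | last => linarith
    | cast j => linarith [z j]
  | cast i =>
    induction j using Fin.lastCases with
    | last =>
      have := Finset.single_le_sum (f := fun i : Fin n => Complex.normSq (g i.castSucc (Fin.last n))) (fun _ _ => Complex.normSq_nonneg _) (Finset.mem_univ i)
      have h2 : Complex.normSq (g i.castSucc (Fin.last n)) ≤ _ := this
      linarith
    | cast j =>
      have := Finset.single_le_sum (f := fun i : Fin n => Complex.normSq (g i.castSucc j.castSucc)) (fun _ _ => Complex.normSq_nonneg _) (Finset.mem_univ i)
      have h2 : Complex.normSq (g i.castSucc j.castSucc) ≤ _ := this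
      linarith [c j, z j]

open Filter Topology in
lemma bdd_seq {n : ℕ} {α β : Fin n → ℝ} (hα : memTnInt n α) (hβ : memTnInt n β)
    {a b : ℕ → Fin n → ℝ} (ha : Tendsto a atTop (𝓝 α)) (hb : Tendsto b atTop (𝓝 β))
    (g : ℕ → MatN n) (hg : ∀ k, memUn n (g k))
    (ht : ∀ k, ‖(Ln n (a k) * g k * Ln n (b k) * (g k)⁻¹).trace‖ ≤ n + 1) :
    ∃ R : ℝ, ∀ᶠ k in atTop, ‖g k (Fin.last n) (Fin.last n)‖ ≤ R := by
  by_contra hcon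
  push Not at hcon
  obtain ⟨φ, hφ, hw⟩ := Filter.extraction_forall_of_frequently (fun m : ℕ => hcon (m + 1 : ℝ))
  set w : ℕ → ℝ := fun m => ‖g (φ m) (Fin.last n) (Fin.last n)‖ with hwdef
  have hwpos : ∀ m, 1 < w m := fun m => lt_of_le_of_lt (by simp) (hw m)
  have hwtop : Tendsto w atTop atTop := by
    apply tendsto_atTop_mono (fun m => (hw m).le)
    exact tendsto_atTop_add_const_right _ _ tendsto_natCast_atTop_atTop
  have hwinv : Tendsto (fun m => (((w m)⁻¹ : ℝ) : ℂ)) atTop (𝓝 0) := by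
    have := (Complex.continuous_ofReal.tendsto 0).comp (tendsto_inv_atTop_zero.comp hwtop)
    rw [Complex.ofReal_zero] at this
    exact this
  set h : ℕ → MatN n := fun m => (((w m)⁻¹ : ℝ) : ℂ) • g (φ m) with hh
  obtain ⟨H, ψ, hψ, hH⟩ := compact_seq h 2 (by
    apply Eventually.of_forall
    intro m i j
    have := entry_bound (hg (φ m)) i j
    rw [Complex.normSq_eq_norm_sq, Complex.normSq_eq_norm_sq] at this
    change _ ≤ 1 + (w m)^2 at this
    simp only [hh, Matrix.smul_apply, smul_eq_mul, norm_mul, Complex.norm_real, norm_inv, Real.norm_eq_abs]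
    rw [abs_of_pos (by linarith [hwpos m]), inv_mul_le_iff₀ (by linarith [hwpos m])]
    have := hwpos m
    apply le_of_sq_le_sq _ (by positivity) 
    nlinarith)
  have hstar : ∀ m, (h m)ᴴ = (((w m)⁻¹ : ℝ) : ℂ) • (g (φ m))ᴴ := by
    intro m
    simp only [hh, conjTranspose_smul]
    congr 1
    exact Complex.conj_ofReal _
  have hHs : Tendsto (fun k => (h (ψ k))ᴴ) atTop (𝓝 Hᴴ) :=
    ((continuous_id.matrix_conjTranspose).tendsto H).comp hH
  have hw2 : Tendsto (fun k => (((w (ψ k))⁻¹ : ℝ) : ℂ) * (((w (ψ k))⁻¹ : ℝ) : ℂ)) atTop (𝓝 0) := by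
    have := (hwinv.mul hwinv).comp hψ.tendsto_atTop
    rw [mul_zero] at this
    exact this
  have e1 : Hᴴ * Jn n * H = 0 := by
    have t1 : Tendsto (fun k => (h (ψ k))ᴴ * Jn n * h (ψ k)) atTop (𝓝 (Hᴴ * Jn n * H)) :=
      (hHs.mul tendsto_const_nhds).mul hH
    refine tendsto_nhds_unique t1 ?_
    have : (fun k => (h (ψ k))ᴴ * Jn n * h (ψ k)) = fun k => ((((w (ψ k))⁻¹ : ℝ) : ℂ) * (((w (ψ k))⁻¹ : ℝ) : ℂ)) • Jn n := by
      ext1 k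
      rw [hstar]
      simp only [hh, Matrix.smul_mul, Matrix.mul_smul, smul_smul]
      rw [hg]
    rw [this]
    simpa using hw2.smul (tendsto_const_nhds (x := Jn n))
  have e2 : H * Jn n * Hᴴ = 0 := by
    have t1 : Tendsto (fun k => h (ψ k) * Jn n * (h (ψ k))ᴴ) atTop (𝓝 (H * Jn n * Hᴴ)) :=
      (hH.mul tendsto_const_nhds).mul hHs
    refine tendsto_nhds_unique t1 ?_
    have : (fun k => h (ψ k) * Jn n * (h (ψ k))ᴴ) = fun k => ((((w (ψ k))⁻¹ : ℝ) : ℂ) * (((w (ψ k))⁻¹ : ℝ) : ℂ)) • Jn n := by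
      ext1 k
      rw [hstar]
      simp only [hh, Matrix.smul_mul, Matrix.mul_smul, smul_smul]
      rw [memUn_right' (hg _)]
    rw [this]
    simpa using hw2.smul (tendsto_const_nhds (x := Jn n))
  have e3 : H (Fin.last n) (Fin.last n) ≠ 0 := by
    have t1 : Tendsto (fun k => ‖h (ψ k) (Fin.last n) (Fin.last n)‖) atTop (𝓝 ‖H (Fin.last n) (Fin.last n)‖) := by
      apply Tendsto.norm
      exact ((continuous_id.matrix_elem (Fin.last n) (Fin.last n)).tendsto H).comp hH
    have : (fun k => ‖h (ψ k) (Fin.last n) (Fin.last n)‖) = fun _ => (1:ℝ) := by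
      ext1 k
      simp only [hh, Matrix.smul_apply, smul_eq_mul, norm_mul, Complex.norm_real, norm_inv, Real.norm_eq_abs]
      have := hwpos (ψ k)
      rw [abs_of_pos (by linarith)]
      exact inv_mul_cancel₀ (by linarith)
    rw [this] at t1
    have := tendsto_nhds_unique t1 tendsto_const_nhds
    rw [← norm_ne_zero_iff, this]; norm_num
  apply limit_trace_ne hα hβ H e1 e2 e3
  have hLa : Tendsto (fun k => Ln n (a (φ (ψ k)))) atTop (𝓝 (Ln n α)) :=
    ((Ln_cont n).tendsto α).comp (ha.comp (hφ.tendsto_atTop.comp hψ.tendsto_atTop))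
  have hLb : Tendsto (fun k => Ln n (b (φ (ψ k)))) atTop (𝓝 (Ln n β)) :=
    ((Ln_cont n).tendsto β).comp (hb.comp (hφ.tendsto_atTop.comp hψ.tendsto_atTop))
  have t1 : Tendsto (fun k => (Ln n (a (φ (ψ k))) * h (ψ k) * Ln n (b (φ (ψ k))) * (Jn n * (h (ψ k))ᴴ * Jn n)).trace) atTop
      (𝓝 (Ln n α * H * Ln n β * (Jn n * Hᴴ * Jn n)).trace) := by
    have c : Continuous (fun M : MatN n => M.trace) := continuous_id.matrix_trace
    refine (c.tendsto _).comp ?_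
    exact ((hLa.mul hH).mul hLb).mul ((tendsto_const_nhds.mul hHs).mul tendsto_const_nhds)
  refine tendsto_nhds_unique t1 ?_
  have : (fun k => (Ln n (a (φ (ψ k))) * h (ψ k) * Ln n (b (φ (ψ k))) * (Jn n * (h (ψ k))ᴴ * Jn n)).trace)
     = fun k => ((((w (ψ k))⁻¹ : ℝ) : ℂ) * (((w (ψ k))⁻¹ : ℝ) : ℂ)) * (Ln n (a (φ (ψ k))) * g (φ (ψ k)) * Ln n (b (φ (ψ k))) * (g (φ (ψ k)))⁻¹).trace := by
    ext1 k
    rw [hstar, memUn_inv (hg _)]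
    simp only [hh, Matrix.smul_mul, Matrix.mul_smul, smul_smul, trace_smul, smul_eq_mul]
  rw [this]
  apply Tendsto.zero_mul_isBoundedUnder_le hw2
  exact isBoundedUnder_of ⟨(n + 1 : ℝ), fun k => ht _⟩

lemma trace_bound {n : ℕ} {u : ℂ} (hu : ‖u‖ = 1) {X g : MatN n} {γ : Fin n → ℝ} (hg : memUn n g)
    (h : X * (g * Ln n γ * g⁻¹) = u • (1 : MatN n)) : ‖X.trace‖ ≤ n + 1 := by
  have h1 : X = u • (g * (Ln n γ)⁻¹ * g⁻¹) := by
    have : X * (g * Ln n γ * g⁻¹) * (g * (Ln n γ)⁻¹ * g⁻¹) = X := by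
      calc _ = X * (g * (Ln n γ * ((g⁻¹ * g) * (Ln n γ)⁻¹)) * g⁻¹) := by simp only [Matrix.mul_assoc]
        _ = _ := by rw [memUn_inv_mul hg, Matrix.one_mul, memUn_mul_inv (memUn_Ln n γ), Matrix.mul_one, memUn_mul_inv hg, Matrix.mul_one]
    rw [← this, h, Matrix.smul_mul, Matrix.one_mul]
  have h2 : (Ln n γ)⁻¹ = Matrix.diagonal (fun i => (lam n γ i)⁻¹) := by
    apply Matrix.inv_eq_left_inv
    rw [Ln_eq, diagonal_mul_diagonal, ← diagonal_one]
    congr 1; ext i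
    exact inv_mul_cancel₀ (lam_ne _ _ _)
  rw [h1, trace_smul, Matrix.trace_mul_comm, ← Matrix.mul_assoc, memUn_inv_mul hg, Matrix.one_mul, h2, trace_diagonal,
    norm_smul, hu, one_mul]
  refine (norm_sum_le _ _).trans ?_
  simp [lam_norm]

lemma psol_iff {n : ℕ} {u : ℂ} {τ : TriN n} : τ ∈ PsolN n u ↔ memTn3 n τ ∧ ∃ g h : MatN n, memUn n g ∧ memUn n h ∧
    Ln n τ.1 * (g * Ln n τ.2.1 * g⁻¹) * (h * Ln n τ.2.2 * h⁻¹) = u • (1 : MatN n) := by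
  constructor
  · rintro ⟨h0, A, B, C, hA, hB, hC, ⟨P, hP, rfl⟩, ⟨Q, hQ, rfl⟩, ⟨R, hR, rfl⟩, h⟩
    refine ⟨h0, P⁻¹ * Q, P⁻¹ * R, memUn_mul (memUn_inv' hP) hQ, memUn_mul (memUn_inv' hP) hR, ?_⟩
    have e : ∀ M : MatN n, (P⁻¹ * M)⁻¹ = M⁻¹ * P := by
      intro M
      rw [Matrix.mul_inv_rev, Matrix.nonsing_inv_nonsing_inv _ (memUn_isUnit_det hP)]
    rw [e, e]
    have h' := congrArg (fun M => P⁻¹ * M * P) h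
    simp only [Matrix.mul_smul, Matrix.smul_mul, Matrix.mul_one, memUn_inv_mul hP] at h'
    rw [← h']
    calc _ = Ln n τ.1 * P⁻¹ * (Q * Ln n τ.2.1 * Q⁻¹) * (P * P⁻¹) * (R * Ln n τ.2.2 * R⁻¹) * P := by simp only [Matrix.mul_assoc]
      _ = (P⁻¹ * P) * Ln n τ.1 * P⁻¹ * (Q * Ln n τ.2.1 * Q⁻¹) * (R * Ln n τ.2.2 * R⁻¹) * P := by
        rw [memUn_mul_inv hP, memUn_inv_mul hP, Matrix.mul_one, Matrix.one_mul]
      _ = _ := by simp only [Matrix.mul_assoc]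
  · rintro ⟨h0, g, h, hg, hh, e⟩
    exact ⟨h0, _, _, _, memUn_Ln n _, memUn_conj hg _, memUn_conj hh _, ⟨1, memUn_one n, by simp⟩, ⟨g, hg, rfl⟩, ⟨h, hh, rfl⟩, e⟩

lemma memTn_of_int {n : ℕ} {α : Fin n → ℝ} (h : memTnInt n α) : memTn n α := by
  refine ⟨fun i => ⟨(h.1 i).1.le, (h.1 i).2⟩, fun i j hij => ?_⟩
  rcases hij.eq_or_lt with rfl | hl
  · exact le_rfl
  · exact (h.2 i j hl).le

lemma memTn3_of_int {n : ℕ} {τ : TriN n} (h : memTnInt3 n τ) : memTn3 n τ :=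
  ⟨memTn_of_int h.1, memTn_of_int h.2.1, memTn_of_int h.2.2⟩

open Filter Topology in
lemma memUn_limit {n : ℕ} {g : ℕ → MatN n} {G : MatN n} (hg : ∀ k, memUn n (g k)) (ht : Tendsto g atTop (𝓝 G)) : memUn n G := by
  have hs : Tendsto (fun k => (g k)ᴴ) atTop (𝓝 Gᴴ) := ((continuous_id.matrix_conjTranspose).tendsto G).comp ht
  have t1 : Tendsto (fun k => (g k)ᴴ * Jn n * g k) atTop (𝓝 (Gᴴ * Jn n * G)) := (hs.mul tendsto_const_nhds).mul ht
  have : (fun k => (g k)ᴴ * Jn n * g k) = fun _ => Jn n := funext hg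
  rw [this] at t1
  exact (tendsto_nhds_unique t1 tendsto_const_nhds)

open Filter Topology in
lemma inv_limit {n : ℕ} {g : ℕ → MatN n} {G : MatN n} (hg : ∀ k, memUn n (g k)) (ht : Tendsto g atTop (𝓝 G)) :
    Tendsto (fun k => (g k)⁻¹) atTop (𝓝 G⁻¹) := by
  have hs : Tendsto (fun k => (g k)ᴴ) atTop (𝓝 Gᴴ) := ((continuous_id.matrix_conjTranspose).tendsto G).comp ht
  rw [memUn_inv (memUn_limit hg ht)]
  simp only [memUn_inv (hg _)]
  exact (tendsto_const_nhds.mul hs).mul tendsto_const_nhds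

open Filter Topology in
lemma closed_part {n : ℕ} {u : ℂ} (hu : ‖u‖ = 1) {τ : TriN n} (hτ : memTnInt3 n τ) (hP : τ ∉ PsolN n u) :
    ∀ᶠ σ in 𝓝 τ, σ ∉ PsolN n u := by
  by_contra hcon
  simp only [not_eventually, not_not] at hcon
  obtain ⟨σ, hσ, hσP⟩ := exists_seq_forall_of_frequently hcon
  apply hP
  rw [psol_iff]
  refine ⟨memTn3_of_int hτ, ?_⟩
  choose g h hg hh he using fun k => (psol_iff.mp (hσP k)).2
  have l1 : Tendsto (fun k => (σ k).1) atTop (𝓝 τ.1) := (continuous_fst.tendsto τ).comp hσ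
  have l2 : Tendsto (fun k => (σ k).2.1) atTop (𝓝 τ.2.1) := ((continuous_fst.comp continuous_snd).tendsto τ).comp hσ
  have l3 : Tendsto (fun k => (σ k).2.2) atTop (𝓝 τ.2.2) := ((continuous_snd.comp continuous_snd).tendsto τ).comp hσ
  have hu0 : u ≠ 0 := by rw [← norm_ne_zero_iff, hu]; norm_num
  have cyc : ∀ X Y : MatN n, X * Y = u • (1 : MatN n) → Y * X = u • (1 : MatN n) := by
    intro X Y hXY
    have : (u⁻¹ • X) * Y = 1 := by rw [Matrix.smul_mul, hXY, smul_smul, inv_mul_cancel₀ hu0, one_smul]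
    have := mul_eq_one_comm.mp this
    rw [Matrix.mul_smul] at this
    rw [← this, smul_smul, mul_inv_cancel₀ hu0, one_smul]
  obtain ⟨R1, hR1⟩ := bdd_seq hτ.1 hτ.2.1 l1 l2 g hg (fun k => by
    apply trace_bound hu (hh k) (γ := (σ k).2.2)
    rw [← he k]; simp only [Matrix.mul_assoc])
  obtain ⟨R2, hR2⟩ := bdd_seq hτ.1 hτ.2.2 l1 l3 h hh (fun k => by
    have e : (h k * Ln n (σ k).2.2 * (h k)⁻¹ * Ln n (σ k).1) * (g k * Ln n (σ k).2.1 * (g k)⁻¹) = u • (1 : MatN n) := by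
      rw [Matrix.mul_assoc]; exact cyc _ _ (he k)
    have := trace_bound hu (hg k) e
    rw [Matrix.trace_mul_comm] at this
    simpa only [Matrix.mul_assoc] using this)
  have bd : ∀ (f : ℕ → MatN n) (R : ℝ), (∀ k, memUn n (f k)) → (∀ᶠ k in atTop, ‖f k (Fin.last n) (Fin.last n)‖ ≤ R) →
      ∀ᶠ k in atTop, ∀ i j, ‖f k i j‖ ≤ 1 + R := by
    intro f R hf hR
    filter_upwards [hR] with k hk i j
    have := entry_bound (hf k) i j
    rw [Complex.normSq_eq_norm_sq, Complex.normSq_eq_norm_sq] at this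
    have h0 := norm_nonneg (f k (Fin.last n) (Fin.last n))
    apply le_of_sq_le_sq _ (by linarith)
    nlinarith
  obtain ⟨G, φ, hφ, hG⟩ := compact_seq g _ (bd g R1 hg hR1)
  obtain ⟨H, ψ, hψ, hH⟩ := compact_seq (fun k => h (φ k)) _ (hφ.tendsto_atTop.eventually (bd h R2 hh hR2))
  have hG' : Tendsto (fun k => g (φ (ψ k))) atTop (𝓝 G) := hG.comp hψ.tendsto_atTop
  have hs : Tendsto (fun k => φ (ψ k)) atTop atTop := hφ.tendsto_atTop.comp hψ.tendsto_atTop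
  refine ⟨G, H, memUn_limit (fun _ => hg _) hG', memUn_limit (fun _ => hh _) hH, ?_⟩
  have t : Tendsto (fun k => Ln n (σ (φ (ψ k))).1 * (g (φ (ψ k)) * Ln n (σ (φ (ψ k))).2.1 * (g (φ (ψ k)))⁻¹) * (h (φ (ψ k)) * Ln n (σ (φ (ψ k))).2.2 * (h (φ (ψ k)))⁻¹)) atTop
      (𝓝 (Ln n τ.1 * (G * Ln n τ.2.1 * G⁻¹) * (H * Ln n τ.2.2 * H⁻¹))) := by
    refine Tendsto.mul (Tendsto.mul ?_ (Tendsto.mul (Tendsto.mul hG' ?_) (inv_limit (fun _ => hg _) hG'))) (Tendsto.mul (Tendsto.mul hH ?_) (inv_limit (fun _ => hh _) hH))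
    · exact ((Ln_cont n).tendsto _).comp (l1.comp hs)
    · exact ((Ln_cont n).tendsto _).comp (l2.comp hs)
    · exact ((Ln_cont n).tendsto _).comp (l3.comp hs)
  simp only [he] at t
  exact tendsto_nhds_unique t tendsto_const_nhds |>.symm ▸ rfl

lemma schur {n : ℕ} {A B C Z : MatN n}
    (hirr : ¬ ∃ W : Submodule ℂ (Fin (n + 1) → ℂ), W ≠ ⊥ ∧ W ≠ ⊤ ∧
      (∀ w ∈ W, A.mulVec w ∈ W) ∧ (∀ w ∈ W, B.mulVec w ∈ W) ∧ (∀ w ∈ W, C.mulVec w ∈ W))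
    (hA : Z * A = A * Z) (hB : Z * B = B * Z) (hC : Z * C = C * Z) : ∃ c : ℂ, Z = c • (1 : MatN n) := by
  obtain ⟨c, hc⟩ := Module.End.exists_eigenvalue (Matrix.mulVecLin Z)
  refine ⟨c, ?_⟩
  set W := Module.End.eigenspace (Matrix.mulVecLin Z) c with hW
  have hmem : ∀ w, w ∈ W ↔ Z.mulVec w = c • w := by
    intro w; rw [hW, Module.End.mem_eigenspace_iff, Matrix.mulVecLin_apply]
  have inv : ∀ X : MatN n, Z * X = X * Z → ∀ w ∈ W, X.mulVec w ∈ W := by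
    intro X hX w hw
    rw [hmem] at hw ⊢
    rw [Matrix.mulVec_mulVec, hX, ← Matrix.mulVec_mulVec, hw, Matrix.mulVec_smul]
  have hne : W ≠ ⊥ := hc
  have htop : W = ⊤ := by
    by_contra h
    exact hirr ⟨W, hne, h, inv A hA, inv B hB, inv C hC⟩
  apply Matrix.ext_of_mulVec_single
  intro i
  have : Pi.single i 1 ∈ W := htop ▸ Submodule.mem_top
  rw [hmem] at this
  rw [this, Matrix.smul_mulVec, Matrix.one_mulVec]

lemma dual_trace {n : ℕ} (f : MatN n →ₗ[ℂ] ℂ) : ∃ Z : MatN n, ∀ M, f M = (Z * M).trace := by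
  refine ⟨Matrix.of fun i j => f (Matrix.single j i 1), fun M => ?_⟩
  conv_lhs => rw [Matrix.matrix_eq_sum_single M]
  simp only [map_sum, Matrix.trace, Matrix.diag_apply, Matrix.mul_apply, Matrix.of_apply]
  rw [Finset.sum_comm]
  apply Finset.sum_congr rfl; intro j _
  apply Finset.sum_congr rfl; intro i _
  have : Matrix.single i j (M i j) = M i j • Matrix.single i j (1:ℂ) := by simp
  rw [this, map_smul, smul_eq_mul, mul_comm]

/-- the differential of the product map -/
def Dlin (n : ℕ) (A B C : MatN n) : MatN n × MatN n →ₗ[ℂ] MatN n where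
  toFun p := A * (p.1 * B - B * p.1) * C + A * B * (p.2 * C - C * p.2)
  map_add' p q := by
    simp only [Prod.fst_add, Prod.snd_add]; noncomm_ring
  map_smul' c p := by
    simp only [Prod.smul_fst, Prod.smul_snd, Matrix.smul_mul, Matrix.mul_smul, ← smul_sub, ← smul_add, RingHom.id_apply]

lemma Dlin_surj {n : ℕ} {A B C : MatN n} {u : ℂ} (hu : u ≠ 0)
    (hirr : ¬ ∃ W : Submodule ℂ (Fin (n + 1) → ℂ), W ≠ ⊥ ∧ W ≠ ⊤ ∧
      (∀ w ∈ W, A.mulVec w ∈ W) ∧ (∀ w ∈ W, B.mulVec w ∈ W) ∧ (∀ w ∈ W, C.mulVec w ∈ W))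
    (h : A * B * C = u • (1 : MatN n)) (M : MatN n) (hM : M.trace = 0) :
    ∃ X Y, Dlin n A B C (X, Y) = M := by
  have cyc : ∀ X Y : MatN n, X * Y = u • (1 : MatN n) → Y * X = u • (1 : MatN n) := by
    intro X Y hXY
    have : (u⁻¹ • X) * Y = 1 := by rw [Matrix.smul_mul, hXY, smul_smul, inv_mul_cancel₀ hu, one_smul]
    have := mul_eq_one_comm.mp this
    rw [Matrix.mul_smul] at this
    rw [← this, smul_smul, mul_inv_cancel₀ hu, one_smul]
  have hBCA : B * C * A = u • (1 : MatN n) := cyc _ _ (by rw [← h, Matrix.mul_assoc])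
  by_contra hcon
  have hnot : M ∉ LinearMap.range (Dlin n A B C) := by
    rintro ⟨⟨X, Y⟩, hXY⟩
    exact hcon ⟨X, Y, hXY⟩
  obtain ⟨f, hf, hker⟩ := Submodule.exists_le_ker_of_notMem hnot
  obtain ⟨Z, hZ⟩ := dual_trace f
  have hz : ∀ X Y, (Z * (A * (X * B - B * X) * C + A * B * (Y * C - C * Y))).trace = 0 := by
    intro X Y
    rw [← hZ]
    exact LinearMap.mem_ker.mp (hker ⟨(X, Y), rfl⟩)
  have e1 : B * C * Z * A = C * Z * A * B := by
    rw [Matrix.ext_iff_trace_mul_right]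
    intro X
    have := hz X 0
    simp only [Matrix.mul_zero, Matrix.zero_mul, sub_zero, add_zero, Matrix.mul_sub, Matrix.sub_mul, trace_sub, sub_eq_zero] at this
    calc _ = ((B * C) * (Z * A * X)).trace := by simp only [Matrix.mul_assoc]
      _ = (Z * (A * (X * B) * C)).trace := by rw [Matrix.trace_mul_comm]; simp only [Matrix.mul_assoc]
      _ = _ := this
      _ = (Z * A * B * X * C).trace := by simp only [Matrix.mul_assoc]
      _ = _ := by rw [Matrix.trace_mul_comm]; simp only [Matrix.mul_assoc]
  have e2 : C * Z * A * B = u • Z := by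
    have : u • Z = Z * (A * B * C) := by rw [h, Matrix.mul_smul, Matrix.mul_one]
    rw [this, Matrix.ext_iff_trace_mul_right]
    intro X
    have := hz 0 X
    simp only [Matrix.mul_zero, Matrix.zero_mul, sub_zero, zero_add, Matrix.mul_sub, trace_sub, sub_eq_zero] at this
    calc _ = (C * (Z * A * B * X)).trace := by simp only [Matrix.mul_assoc]
      _ = (Z * (A * B * (X * C))).trace := by rw [Matrix.trace_mul_comm]; simp only [Matrix.mul_assoc]
      _ = _ := this
      _ = _ := by simp only [Matrix.mul_assoc]
  have inj : ∀ X Y : MatN n, u • X = u • Y → X = Y := fun X Y h => smul_right_injective _ hu h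
  have cC : Z * C = C * Z := by
    apply inj
    rw [← Matrix.smul_mul, ← e2]
    calc _ = C * Z * (A * B * C) := by simp only [Matrix.mul_assoc]
      _ = _ := by rw [h, Matrix.mul_smul, Matrix.mul_one]
  have cA : Z * A = A * Z := by
    apply inj
    rw [← Matrix.mul_smul A u Z, ← e2, ← e1]
    calc _ = (u • (1 : MatN n)) * (Z * A) := by simp
      _ = (A * B * C) * (Z * A) := by rw [h]
      _ = _ := by simp only [Matrix.mul_assoc]
  have cB : Z * B = B * Z := by
    apply inj
    rw [← Matrix.mul_smul B u Z, ← e2]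
    calc _ = (u • (1 : MatN n)) * (Z * B) := by simp
      _ = (B * C * A) * (Z * B) := by rw [hBCA]
      _ = B * C * (A * Z) * B := by simp only [Matrix.mul_assoc]
      _ = _ := by rw [← cA]; simp only [Matrix.mul_assoc]
  obtain ⟨c, hc⟩ := schur hirr cA cB cC
  apply hf
  rw [hZ, hc, Matrix.smul_mul, Matrix.one_mul, trace_smul, hM, smul_zero]

/-- projection onto `u(n,1)` -/
def prL (n : ℕ) : MatN n →ₗ[ℝ] MatN n where
  toFun M := (1/2 : ℝ) • (M - Jn n * Mᴴ * Jn n)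
  map_add' M N := by
    rw [← smul_add]; congr 1
    rw [conjTranspose_add]; noncomm_ring
  map_smul' c M := by
    rw [RingHom.id_apply, smul_comm c]; congr 1
    rw [conjTranspose_smul, star_trivial, Matrix.mul_smul, Matrix.smul_mul, smul_sub]

lemma prL_apply (n : ℕ) (M : MatN n) : prL n M = (1/2 : ℝ) • (M - Jn n * Mᴴ * Jn n) := rfl

lemma J_smul_J (n : ℕ) (M : MatN n) : Jn n * (Jn n * M * Jn n) * Jn n = M := by
  calc _ = (Jn n * Jn n) * M * (Jn n * Jn n) := by simp only [Matrix.mul_assoc]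
    _ = M := by rw [Jn_sq, Matrix.one_mul, Matrix.mul_one]

lemma prL_star (n : ℕ) (M : MatN n) : Jn n * (prL n M)ᴴ * Jn n = - prL n M := by
  rw [prL_apply, conjTranspose_smul, star_trivial, Matrix.mul_smul, Matrix.smul_mul, ← smul_neg]
  congr 1
  rw [conjTranspose_sub, conjTranspose_mul, conjTranspose_mul, conjTranspose_conjTranspose, Jn_star,
    Matrix.mul_sub, Matrix.sub_mul, ← Matrix.mul_assoc (Jn n) M, J_smul_J]
  abel

lemma prL_of_star {n : ℕ} {M : MatN n} (h : Jn n * Mᴴ * Jn n = - M) : prL n M = M := by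
  rw [prL_apply, h, sub_neg_eq_add, ← two_smul ℝ M, smul_smul]; norm_num

lemma prL_prL (n : ℕ) (M : MatN n) : prL n (prL n M) = prL n M := prL_of_star (prL_star n M)

lemma prL_conj {n : ℕ} {g : MatN n} (hg : memUn n g) (M : MatN n) :
    prL n (g * M * g⁻¹) = g * prL n M * g⁻¹ := by
  simp only [prL_apply, Matrix.mul_smul, Matrix.smul_mul, Matrix.mul_sub, Matrix.sub_mul]
  congr 2
  rw [memUn_inv hg]
  simp only [conjTranspose_mul, conjTranspose_conjTranspose, Jn_star]
  calc _ = (Jn n * Jn n) * g * Jn n * Mᴴ * gᴴ * Jn n := by simp only [Matrix.mul_assoc]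
    _ = g * Jn n * Mᴴ * (Jn n * Jn n) * gᴴ * Jn n := by rw [Jn_sq, Matrix.one_mul, Matrix.mul_one]
    _ = _ := by simp only [Matrix.mul_assoc]

/-- projection onto `su(n,1)` -/
def piL (n : ℕ) : MatN n →ₗ[ℝ] MatN n where
  toFun M := prL n M - (((n : ℂ) + 1)⁻¹ * (prL n M).trace) • (1 : MatN n)
  map_add' M N := by
    rw [map_add, trace_add, mul_add, add_smul]; abel
  map_smul' c M := by
    rw [map_smul, trace_smul, RingHom.id_apply, smul_sub, mul_smul_comm, smul_assoc]

lemma piL_apply (n : ℕ) (M : MatN n) : piL n M = prL n M - (((n : ℂ) + 1)⁻¹ * (prL n M).trace) • (1 : MatN n) := rfl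

lemma piL_trace (n : ℕ) (M : MatN n) : (piL n M).trace = 0 := by
  have : (n : ℂ) + 1 ≠ 0 := by exact_mod_cast Nat.succ_ne_zero n
  rw [piL_apply, trace_sub, trace_smul, trace_one, Fintype.card_fin, smul_eq_mul]
  push_cast
  field_simp
  ring

lemma prL_piL (n : ℕ) (M : MatN n) : prL n (piL n M) = piL n M := by
  apply prL_of_star
  have h1 := prL_star n M
  have h2 : star ((prL n M).trace) = - (prL n M).trace := by
    rw [← trace_conjTranspose, ← trace_neg, ← h1, Matrix.trace_mul_comm, ← Matrix.mul_assoc, Jn_sq, Matrix.one_mul]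
  rw [piL_apply, conjTranspose_sub, conjTranspose_smul, conjTranspose_one, Matrix.mul_sub, Matrix.sub_mul, h1,
    Matrix.mul_smul, Matrix.smul_mul, Matrix.mul_one, Jn_sq, star_mul', h2]
  have h3 : star (((n : ℂ) + 1)⁻¹) = ((n : ℂ) + 1)⁻¹ := by simp
  rw [h3, mul_neg, neg_smul]; abel

lemma piL_of {n : ℕ} {M : MatN n} (h : prL n M = M) (ht : M.trace = 0) : piL n M = M := by
  rw [piL_apply, h, ht, mul_zero, zero_smul, sub_zero]

lemma piL_piL (n : ℕ) (M : MatN n) : piL n (piL n M) = piL n M := piL_of (prL_piL n M) (piL_trace n M)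

lemma Dlin_real {n : ℕ} {A B C : MatN n} {u : ℂ} (hu : u ≠ 0)
    (hA : memUn n A) (hB : memUn n B)
    (hirr : ¬ ∃ W : Submodule ℂ (Fin (n + 1) → ℂ), W ≠ ⊥ ∧ W ≠ ⊤ ∧
      (∀ w ∈ W, A.mulVec w ∈ W) ∧ (∀ w ∈ W, B.mulVec w ∈ W) ∧ (∀ w ∈ W, C.mulVec w ∈ W))
    (h : A * B * C = u • (1 : MatN n)) (M : MatN n) :
    ∃ X Y, u⁻¹ • Dlin n A B C (prL n X, prL n Y) = piL n M := by
  have hAB := memUn_mul hA hB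
  have hCe : C = u • (A * B)⁻¹ := by
    have := congrArg (fun N => (A * B)⁻¹ * N) h
    simp only [← Matrix.mul_assoc (A * B)⁻¹ (A * B) C, Matrix.mul_smul, Matrix.mul_one] at this
    rwa [memUn_inv_mul hAB, Matrix.one_mul] at this
  have hBi : B * (A * B)⁻¹ = A⁻¹ := by
    rw [Matrix.mul_inv_rev, ← Matrix.mul_assoc, memUn_mul_inv hB, Matrix.one_mul]
  have form : ∀ X Y, u⁻¹ • Dlin n A B C (X, Y) = A * X * A⁻¹ - (A * B) * X * (A * B)⁻¹ + ((A * B) * Y * (A * B)⁻¹ - Y) := by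
    intro X Y
    change u⁻¹ • (A * (X * B - B * X) * C + A * B * (Y * C - C * Y)) = _
    have : A * (X * B - B * X) * C + A * B * (Y * C - C * Y) =
      u • (A * X * (B * (A * B)⁻¹) - (A * B) * X * (A * B)⁻¹ + ((A * B) * Y * (A * B)⁻¹ - (A * B) * (A * B)⁻¹ * Y)) := by
      rw [hCe]
      simp only [Matrix.mul_sub, Matrix.sub_mul, smul_sub, smul_add, Matrix.mul_smul, Matrix.smul_mul, Matrix.mul_assoc]
    rw [this, smul_smul, inv_mul_cancel₀ hu, one_smul, hBi, memUn_mul_inv hAB, Matrix.one_mul]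
  obtain ⟨X, Y, hXY⟩ := Dlin_surj hu hirr h (u • piL n M) (by rw [trace_smul, piL_trace, smul_zero])
  refine ⟨X, Y, ?_⟩
  have h1 := form X Y
  rw [hXY, smul_smul, inv_mul_cancel₀ hu, one_smul] at h1
  rw [form, ← prL_piL, h1]
  simp only [map_add, map_sub, prL_conj hA, prL_conj hAB]

lemma memUn_exp {n : ℕ} (X : MatN n) : memUn n (NormedSpace.exp (prL n X)) := by
  have hJ : (Jn n)⁻¹ = Jn n := Matrix.inv_eq_left_inv (Jn_sq n)
  have hJu : IsUnit (Jn n) := IsUnit.of_mul_eq_one _ (Jn_sq n)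
  have h1 : (prL n X)ᴴ = Jn n * (- prL n X) * (Jn n)⁻¹ := by
    rw [← prL_star, hJ, J_smul_J]
  unfold memUn
  rw [← Matrix.exp_conjTranspose, h1, Matrix.exp_conj _ _ hJu, Matrix.exp_neg, hJ]
  have hu : IsUnit (NormedSpace.exp (prL n X)).det := (Matrix.isUnit_iff_isUnit_det _).mp (Matrix.isUnit_exp _)
  calc _ = Jn n * ((NormedSpace.exp (prL n X))⁻¹ * (Jn n * Jn n) * NormedSpace.exp (prL n X)) := by simp only [Matrix.mul_assoc]
    _ = _ := by rw [Jn_sq, Matrix.mul_one, Matrix.nonsing_inv_mul _ hu, Matrix.mul_one]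

section analysis

open Filter Topology
open scoped Matrix.Norms.Operator

lemma near_one {n : ℕ} {U : MatN n} (hU : memUn n U) (hpi : piL n U = 0) (hn1 : ‖U - 1‖ < 1) :
    ∃ μ : ℂ, U = μ • (1 : MatN n) := by
  have heig : ∀ (ν : ℂ) (v : Fin (n+1) → ℂ), v ≠ 0 → U.mulVec v = ν • v → 0 < ν.re := by
    intro ν v hv h
    have h1 : (U - 1).mulVec v = (ν - 1) • v := by
      rw [Matrix.sub_mulVec, h, Matrix.one_mulVec, sub_smul, one_smul]
    have h2 := Matrix.linfty_opNorm_mulVec (U - 1) v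
    rw [h1, norm_smul] at h2
    have hv' : 0 < ‖v‖ := norm_pos_iff.mpr hv
    have h3 : ‖ν - 1‖ < 1 := lt_of_le_of_lt (le_of_mul_le_mul_right h2 hv') hn1
    have h4 := Complex.abs_re_le_norm (ν - 1)
    rw [Complex.sub_re, Complex.one_re] at h4
    have := (abs_le.mp h4).1
    linarith
  obtain ⟨μ, hμ⟩ := Module.End.exists_eigenvalue (Matrix.mulVecLin U)
  obtain ⟨v, hv⟩ := hμ.exists_hasEigenvector
  have hv0 : v ≠ 0 := hv.2
  have hUv : U.mulVec v = μ • v := by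
    have := hv.apply_eq_smul
    rwa [Matrix.mulVecLin_apply] at this
  have hμre := heig μ v hv0 hUv
  have hμ0 : μ ≠ 0 := by rintro rfl; simp at hμre
  set c : ℂ := ((n : ℂ) + 1)⁻¹ * (prL n U).trace with hc
  have h1 : U - U⁻¹ = (2 * c) • (1 : MatN n) := by
    rw [piL_apply, sub_eq_zero, ← hc] at hpi
    rw [mul_smul, ← hpi, prL_apply, ← memUn_inv hU]
    ext i j
    simp
  have h2 : U * U - (2 * c) • U = 1 := by
    have := congrArg (fun M => M * U) h1
    simp only [Matrix.sub_mul, memUn_inv_mul hU, Matrix.smul_mul, Matrix.one_mul] at this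
    rw [← this]; abel
  have h3 : μ * μ - 2 * c * μ = 1 := by
    have := congrArg (fun M => M.mulVec v) h2
    simp only [Matrix.sub_mulVec, ← Matrix.mulVec_mulVec, hUv, Matrix.mulVec_smul, Matrix.smul_mulVec, Matrix.one_mulVec, smul_smul, ← sub_smul] at this
    have h4 : (μ * μ - 2 * c * μ - 1) • v = 0 := by rw [sub_smul, this, one_smul, sub_self]
    exact sub_eq_zero.mp ((smul_eq_zero.mp h4).resolve_right hv0)
  have h2c : 2 * c = μ - μ⁻¹ := by field_simp; linear_combination -h3
  have h5 : (U + μ⁻¹ • (1 : MatN n)) * (U - μ • (1 : MatN n)) = 0 := by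
    have : (U + μ⁻¹ • (1 : MatN n)) * (U - μ • (1 : MatN n)) = (U * U - (μ - μ⁻¹) • U) - (μ⁻¹ * μ) • (1 : MatN n) := by
      simp only [Matrix.add_mul, Matrix.mul_sub, Matrix.mul_smul, Matrix.smul_mul, Matrix.mul_one, Matrix.one_mul, smul_smul, smul_add, sub_smul, mul_comm μ]
      abel
    rw [this, ← h2c, h2, inv_mul_cancel₀ hμ0, one_smul, sub_self]
  have hdet : IsUnit (U + μ⁻¹ • (1 : MatN n)).det := by
    rw [isUnit_iff_ne_zero]
    intro h0
    obtain ⟨x, hx, hx0⟩ := Matrix.exists_mulVec_eq_zero_iff.mpr h0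
    have h6 : U.mulVec x = (-μ⁻¹) • x := by
      rw [Matrix.add_mulVec, Matrix.smul_mulVec, Matrix.one_mulVec] at hx0
      rw [neg_smul]; exact eq_neg_of_add_eq_zero_left hx0
    have h7 := heig _ x hx h6
    rw [Complex.neg_re, Complex.inv_re] at h7
    have : 0 ≤ μ.re / Complex.normSq μ := div_nonneg hμre.le (Complex.normSq_nonneg _)
    linarith
  refine ⟨μ, ?_⟩
  have := congrArg (fun M => (U + μ⁻¹ • (1 : MatN n))⁻¹ * M) h5
  simp only [← Matrix.mul_assoc, Matrix.nonsing_inv_mul _ hdet, Matrix.one_mul, Matrix.mul_zero] at this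
  exact sub_eq_zero.mp this

lemma near_one_ev (n : ℕ) : ∀ᶠ U in 𝓝 (1 : MatN n), memUn n U → U.det = 1 → piL n U = 0 → U = 1 := by
  have e1 : ∀ᶠ U in 𝓝 (1 : MatN n), ‖U - 1‖ < 1 := by
    have : Continuous (fun U : MatN n => ‖U - 1‖) := by fun_prop
    apply this.continuousAt.eventually_lt_const
    simp
  have hfin : ({z : ℂ | z ^ (n+1) = 1} \ {1}).Finite := by
    apply Set.Finite.sdiff
    refine ((Polynomial.nthRoots (n+1) (1:ℂ)).toFinset.finite_toSet).subset ?_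
    intro z hz
    simpa [Polynomial.mem_nthRoots] using hz
  have e2 : ∀ᶠ U in 𝓝 (1 : MatN n), U 0 0 ∈ ({z : ℂ | z ^ (n+1) = 1} \ {1})ᶜ := by
    have c : Continuous (fun U : MatN n => U 0 0) := continuous_id.matrix_elem 0 0
    apply c.continuousAt.eventually_mem
    apply hfin.isClosed.isOpen_compl.mem_nhds
    simp
  filter_upwards [e1, e2] with U h1 h2 hU hd hpi
  obtain ⟨μ, rfl⟩ := near_one hU hpi h1
  rw [det_smul, det_one, mul_one, Fintype.card_fin] at hd
  have : μ = 1 := by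
    by_contra hne
    apply h2
    simpa using ⟨hd, hne⟩
  rw [this, one_smul]

lemma Ln_contDiff (n : ℕ) : ContDiff ℝ 1 (Ln n) := by
  have : Ln n = fun α => ∑ i, lam n α i • Matrix.single i i (1:ℂ) := by
    ext1 α
    rw [Ln_eq]
    simp [Matrix.sum_single_eq_diagonal]
  rw [this]
  apply ContDiff.sum
  intro i _
  exact (lam_contDiff n i).smul contDiff_const

lemma exp_contDiff (n : ℕ) : ContDiff ℝ 1 (fun X : MatN n => NormedSpace.exp X) :=
  contDiff_iff_contDiffAt.mpr fun X => (NormedSpace.exp_analytic (𝕂 := ℝ) X).contDiffAt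

/-- the product with perturbed conjugators -/
def Uf (n : ℕ) (u : ℂ) (P Q R : MatN n) (x : TriN n × MatN n × MatN n × MatN n) : MatN n :=
  u⁻¹ • ((P * Ln n x.1.1 * P⁻¹) *
    (NormedSpace.exp (prL n x.2.1) * (Q * Ln n x.1.2.1 * Q⁻¹) * NormedSpace.exp (-prL n x.2.1)) *
    (NormedSpace.exp (prL n x.2.2.1) * (R * Ln n x.1.2.2 * R⁻¹) * NormedSpace.exp (-prL n x.2.2.1)))

def Gf (n : ℕ) (u : ℂ) (P Q R : MatN n) (x : TriN n × MatN n × MatN n × MatN n) : TriN n × MatN n :=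
  (x.1, piL n (Uf n u P Q R x) + (x.2.2.2 - piL n x.2.2.2))

lemma lin_contDiff {n : ℕ} (f : MatN n →ₗ[ℝ] MatN n) : ContDiff ℝ 1 f :=
  (LinearMap.toContinuousLinearMap f).contDiff

lemma Uf_contDiff (n : ℕ) (u : ℂ) (P Q R : MatN n) : ContDiff ℝ 1 (Uf n u P Q R) := by
  unfold Uf
  apply ContDiff.const_smul
  have c1 : ContDiff ℝ 1 (fun x : TriN n × MatN n × MatN n × MatN n => Ln n x.1.1) := (Ln_contDiff n).comp (by fun_prop)
  have c2 : ContDiff ℝ 1 (fun x : TriN n × MatN n × MatN n × MatN n => Ln n x.1.2.1) := (Ln_contDiff n).comp (by fun_prop)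
  have c3 : ContDiff ℝ 1 (fun x : TriN n × MatN n × MatN n × MatN n => Ln n x.1.2.2) := (Ln_contDiff n).comp (by fun_prop)
  have p1 : ContDiff ℝ 1 (fun x : TriN n × MatN n × MatN n × MatN n => prL n x.2.1) := (lin_contDiff (prL n)).comp (by fun_prop)
  have p2 : ContDiff ℝ 1 (fun x : TriN n × MatN n × MatN n × MatN n => prL n x.2.2.1) := (lin_contDiff (prL n)).comp (by fun_prop)
  have e1 := (exp_contDiff n).comp p1
  have e2 := (exp_contDiff n).comp p2
  have f1 := (exp_contDiff n).comp p1.neg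
  have f2 := (exp_contDiff n).comp p2.neg
  exact ((((contDiff_const.mul c1).mul contDiff_const).mul ((e1.mul ((contDiff_const.mul c2).mul contDiff_const)).mul f1)).mul
    ((e2.mul ((contDiff_const.mul c3).mul contDiff_const)).mul f2))

lemma Gf_contDiff (n : ℕ) (u : ℂ) (P Q R : MatN n) : ContDiff ℝ 1 (Gf n u P Q R) := by
  unfold Gf
  have p1 : ContDiff ℝ 1 (fun x : TriN n × MatN n × MatN n × MatN n => piL n x.2.2.2) := (lin_contDiff (piL n)).comp (by fun_prop)
  have p2 := (lin_contDiff (piL n)).comp (Uf_contDiff n u P Q R)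
  refine ContDiff.prodMk (by fun_prop) (p2.add (ContDiff.sub (by fun_prop) p1))

lemma exp_line {𝔸 : Type*} [NormedRing 𝔸] [NormedAlgebra ℝ 𝔸] [CompleteSpace 𝔸] (M : 𝔸) :
    HasDerivAt (fun t : ℝ => NormedSpace.exp (t • M)) M 0 := by
  have := hasDerivAt_exp_smul_const (𝕂 := ℝ) M 0
  rw [zero_smul, NormedSpace.exp_zero, one_mul] at this
  exact this

lemma conj_line {𝔸 : Type*} [NormedRing 𝔸] [NormedAlgebra ℝ 𝔸] [CompleteSpace 𝔸] (A B C X Y : 𝔸) :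
    HasDerivAt (fun t : ℝ => A * (NormedSpace.exp (t • X) * B * NormedSpace.exp (t • (-X))) *
      (NormedSpace.exp (t • Y) * C * NormedSpace.exp (t • (-Y))))
      (A * (X * B - B * X) * C + A * B * (Y * C - C * Y)) 0 := by
  have main := ((((exp_line X).mul_const B).mul (exp_line (-X))).const_mul A).mul
    (((exp_line Y).mul_const C).mul (exp_line (-Y)))
  refine main.congr_deriv ?_
  simp only [zero_smul, NormedSpace.exp_zero, one_mul, mul_one, mul_neg, sub_eq_add_neg, Pi.mul_apply]

lemma Uf_deriv (n : ℕ) (u : ℂ) (P Q R : MatN n) (τ : TriN n) (X Y W : MatN n) :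
    HasDerivAt (fun t : ℝ => Uf n u P Q R (τ, t • X, t • Y, t • W))
      (u⁻¹ • Dlin n (P * Ln n τ.1 * P⁻¹) (Q * Ln n τ.2.1 * Q⁻¹) (R * Ln n τ.2.2 * R⁻¹) (prL n X, prL n Y)) 0 := by
  unfold Uf
  dsimp only
  generalize (P * Ln n τ.1 * P⁻¹) = A
  generalize (Q * Ln n τ.2.1 * Q⁻¹) = B
  generalize (R * Ln n τ.2.2 * R⁻¹) = C
  simp only [map_smul, ← smul_neg]
  have hD : Dlin n A B C (prL n X, prL n Y) =
    A * (prL n X * B - B * prL n X) * C + A * B * (prL n Y * C - C * prL n Y) := rfl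
  rw [hD]
  exact (conj_line A B C (prL n X) (prL n Y)).const_smul u⁻¹

lemma open_part {n : ℕ} {u : ℂ} (hu : u ^ (n + 1) = 1) {τ : TriN n}
    (hred : τ ∉ PsolRedN n u) (hP : τ ∈ PsolN n u) :
    ∀ᶠ σ in 𝓝 τ, memTnInt3 n σ → σ ∈ PsolN n u := by
  have hu1 : ‖u‖ = 1 := Complex.norm_eq_one_of_pow_eq_one hu (Nat.succ_ne_zero n)
  have hu0 : u ≠ 0 := by rw [← norm_ne_zero_iff, hu1]; norm_num
  obtain ⟨h0, A, B, C, hA, hB, hC, ⟨P, hPP, eA⟩, ⟨Q, hQQ, eB⟩, ⟨R, hRR, eC⟩, h⟩ := hP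
  have hirr : ¬ ∃ W : Submodule ℂ (Fin (n + 1) → ℂ), W ≠ ⊥ ∧ W ≠ ⊤ ∧
      (∀ w ∈ W, A.mulVec w ∈ W) ∧ (∀ w ∈ W, B.mulVec w ∈ W) ∧ (∀ w ∈ W, C.mulVec w ∈ W) := by
    intro hW
    exact hred ⟨h0, A, B, C, hA, hB, hC, ⟨P, hPP, eA⟩, ⟨Q, hQQ, eB⟩, ⟨R, hRR, eC⟩, h, hW⟩
  set x0 : TriN n × MatN n × MatN n × MatN n := (τ, 0, 0, 0) with hx0
  have hU0 : Uf n u P Q R x0 = 1 := by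
    simp only [Uf, hx0, map_zero, neg_zero, NormedSpace.exp_zero, one_mul, mul_one]
    rw [← eA, ← eB, ← eC, h, smul_smul, inv_mul_cancel₀ hu0, one_smul]
  have hpi1 : piL n (1 : MatN n) = 0 := by
    have : prL n (1 : MatN n) = 0 := by
      rw [prL_apply, conjTranspose_one, Matrix.mul_one, Jn_sq, sub_self, smul_zero]
    rw [piL_apply, this]; simp
  have hG0 : Gf n u P Q R x0 = (τ, 0) := by
    unfold Gf
    rw [hU0, hpi1]
    simp [hx0]
  have hstrict : HasStrictFDerivAt (Gf n u P Q R) (fderiv ℝ (Gf n u P Q R) x0) x0 :=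
    (Gf_contDiff n u P Q R).contDiffAt.hasStrictFDerivAt (by norm_num)
  have hline : ∀ X Y W : MatN n, fderiv ℝ (Gf n u P Q R) x0 (0, X, Y, W) =
      (0, piL n (u⁻¹ • Dlin n A B C (prL n X, prL n Y)) + (W - piL n W)) := by
    intro X Y W
    have d1 : HasDerivAt (fun t : ℝ => ((τ, t • X, t • Y, t • W) : TriN n × MatN n × MatN n × MatN n)) (0, X, Y, W) 0 := by
      have ds : ∀ M : MatN n, HasDerivAt (fun t : ℝ => t • M) M 0 := by
        intro M
        have := (hasDerivAt_id (0:ℝ)).smul_const M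
        rw [one_smul] at this
        exact this
      exact (hasDerivAt_const _ _).prodMk ((ds X).prodMk ((ds Y).prodMk (ds W)))
    have hb : ((τ, (0:ℝ) • X, (0:ℝ) • Y, (0:ℝ) • W) : TriN n × MatN n × MatN n × MatN n) = x0 := by simp [hx0]
    have d2 : HasDerivAt (fun t : ℝ => Gf n u P Q R (τ, t • X, t • Y, t • W)) (fderiv ℝ (Gf n u P Q R) x0 (0, X, Y, W)) 0 := by
      have := hstrict.hasFDerivAt
      rw [← hb] at this
      rw [← hb]
      exact this.comp_hasDerivAt (0:ℝ) d1
    have d3 : HasDerivAt (fun t : ℝ => Gf n u P Q R (τ, t • X, t • Y, t • W))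
        (0, piL n (u⁻¹ • Dlin n A B C (prL n X, prL n Y)) + (W - piL n W)) 0 := by
      unfold Gf
      apply (hasDerivAt_const _ _).prodMk
      have k1 : HasDerivAt (fun t : ℝ => piL n (Uf n u P Q R (τ, t • X, t • Y, t • W))) (piL n (u⁻¹ • Dlin n A B C (prL n X, prL n Y))) 0 := by
        have := Uf_deriv n u P Q R τ X Y W
        rw [← eA, ← eB, ← eC] at this
        exact ((LinearMap.toContinuousLinearMap (piL n)).hasFDerivAt.comp_hasDerivAt (0:ℝ) this)
      have k2 : HasDerivAt (fun t : ℝ => t • W - piL n (t • W)) (W - piL n W) 0 := by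
        simp only [map_smul, ← smul_sub]
        have := (hasDerivAt_id (0:ℝ)).smul_const (W - piL n W)
        rw [one_smul] at this
        exact this
      exact k1.add k2
    exact d2.unique d3
  have hsurj : (fderiv ℝ (Gf n u P Q R) x0).range = ⊤ := by
    rw [LinearMap.range_eq_top]
    rintro ⟨s, M⟩
    have hfst : ∀ y, (fderiv ℝ (Gf n u P Q R) x0 y).1 = y.1 := by
      intro y
      have f1 : HasFDerivAt (fun x => (Gf n u P Q R x).1) ((ContinuousLinearMap.fst ℝ _ _).comp (fderiv ℝ (Gf n u P Q R) x0)) x0 :=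
        hasFDerivAt_fst.comp x0 hstrict.hasFDerivAt
      have f2 : HasFDerivAt (fun x => (Gf n u P Q R x).1) (ContinuousLinearMap.fst ℝ (TriN n) (MatN n × MatN n × MatN n)) x0 :=
        hasFDerivAt_fst
      exact congrArg (fun F => F y) (f1.unique f2)
    set M' := M - (fderiv ℝ (Gf n u P Q R) x0 (s, 0, 0, 0)).2 with hM'
    obtain ⟨X, Y, hXY⟩ := Dlin_real hu0 hA hB hirr h M'
    refine ⟨(s, 0, 0, 0) + (0, X, Y, M'), ?_⟩
    change fderiv ℝ (Gf n u P Q R) x0 _ = _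
    rw [map_add, hline, hXY, piL_piL]
    ext1
    · rw [Prod.fst_add, hfst]; simp
    · rw [Prod.snd_add]
      simp only [hM']
      abel
  have hmap := hstrict.map_nhds_eq_of_surj hsurj
  rw [hG0] at hmap
  have hev : ∀ᶠ x in 𝓝 x0, (memUn n (Uf n u P Q R x) → (Uf n u P Q R x).det = 1 → piL n (Uf n u P Q R x) = 0 → Uf n u P Q R x = 1) := by
    have : ContinuousAt (Uf n u P Q R) x0 := (Uf_contDiff n u P Q R).continuous.continuousAt
    have t := this.tendsto
    rw [hU0] at t
    exact t.eventually (near_one_ev n)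
  have himg : (Gf n u P Q R) '' {x | memUn n (Uf n u P Q R x) → (Uf n u P Q R x).det = 1 → piL n (Uf n u P Q R x) = 0 → Uf n u P Q R x = 1} ∈ 𝓝 ((τ, 0) : TriN n × MatN n) := by
    have := image_mem_map (m := Gf n u P Q R) hev
    exact hmap.ge this
  have hτ : ∀ᶠ σ in 𝓝 τ, ((σ, 0) : TriN n × MatN n) ∈ (Gf n u P Q R) '' {x | memUn n (Uf n u P Q R x) → (Uf n u P Q R x).det = 1 → piL n (Uf n u P Q R x) = 0 → Uf n u P Q R x = 1} := by
    have c : Continuous (fun σ : TriN n => ((σ, 0) : TriN n × MatN n)) := by fun_prop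
    exact c.continuousAt.eventually_mem himg
  filter_upwards [hτ] with σ hσ hσint
  obtain ⟨⟨σ', X, Y, W⟩, hx, hGx⟩ := hσ
  have hσ' : σ' = σ := congrArg Prod.fst hGx
  subst hσ'
  have h2 : piL n (Uf n u P Q R (σ', X, Y, W)) + (W - piL n W) = 0 := congrArg Prod.snd hGx
  have h3 : piL n (Uf n u P Q R (σ', X, Y, W)) = 0 := by
    have := congrArg (piL n) h2
    rwa [map_add, map_sub, piL_piL, piL_piL, sub_self, add_zero, map_zero] at this
  have inv : ∀ M K S : MatN n, NormedSpace.exp (prL n M) * (K * S * K⁻¹) * NormedSpace.exp (-prL n M) =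
      (NormedSpace.exp (prL n M) * K) * S * (NormedSpace.exp (prL n M) * K)⁻¹ := by
    intro M K S
    rw [Matrix.exp_neg, Matrix.mul_inv_rev]; simp only [Matrix.mul_assoc]
  have hXQ := memUn_mul (memUn_exp X) hQQ
  have hYR := memUn_mul (memUn_exp Y) hRR
  have hUe : Uf n u P Q R (σ', X, Y, W) = u⁻¹ • ((P * Ln n σ'.1 * P⁻¹) *
     ((NormedSpace.exp (prL n X) * Q) * Ln n σ'.2.1 * (NormedSpace.exp (prL n X) * Q)⁻¹) *
     ((NormedSpace.exp (prL n Y) * R) * Ln n σ'.2.2 * (NormedSpace.exp (prL n Y) * R)⁻¹)) := by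
    unfold Uf
    rw [← inv, ← inv]
  have hdet : ∀ (K : MatN n) (α), memUn n K → (K * Ln n α * K⁻¹).det = 1 := by
    intro K α hK
    rw [Matrix.det_conj (((Matrix.isUnit_iff_isUnit_det _).mpr (memUn_isUnit_det hK))), Ln_det]
  have h1 := hx (by
      rw [hUe]
      exact memUn_smul (memUn_mul (memUn_mul (memUn_conj hPP _) (memUn_conj hXQ _)) (memUn_conj hYR _)) (by rw [norm_inv, hu1, inv_one]))
    (by
      rw [hUe, det_smul, det_mul, det_mul, hdet _ _ hPP, hdet _ _ hXQ, hdet _ _ hYR, Fintype.card_fin, inv_pow, hu]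
      norm_num) h3
  refine ⟨memTn3_of_int hσint, _, _, _, memUn_conj hPP _, memUn_conj hXQ _, memUn_conj hYR _, ⟨P, hPP, rfl⟩, ⟨_, hXQ, rfl⟩, ⟨_, hYR, rfl⟩, ?_⟩
  rw [hUe] at h1
  rw [← h1, smul_smul, mul_inv_cancel₀ hu0, one_smul]

end analysis


/-- Full-or-empty dichotomy for cells: a connected component of the complement of the
reducible walls is either contained in the solution set or disjoint from it. -/
theorem full_or_empty_dichotomy (n : ℕ) (hn : 1 ≤ n) (u : ℂ) (hu : u ^ (n + 1) = 1)
    (C : Set (TriN n)) (x : TriN n)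
    (hx : x ∈ {τ : TriN n | memTnInt3 n τ} \ PsolRedN n u)
    (hC : C = connectedComponentIn ({τ : TriN n | memTnInt3 n τ} \ PsolRedN n u) x) :
    C ⊆ PsolN n u ∨ C ∩ PsolN n u = ∅ := by
  have hu1 : ‖u‖ = 1 := Complex.norm_eq_one_of_pow_eq_one hu (Nat.succ_ne_zero n)
  have hsub : C ⊆ {τ : TriN n | memTnInt3 n τ} \ PsolRedN n u := by
    rw [hC]; exact connectedComponentIn_subset _ _
  have hpre : IsPreconnected C := by
    rw [hC]; exact isPreconnected_connectedComponentIn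
  rw [isPreconnected_iff_subset_of_disjoint] at hpre
  have key := hpre (interior {σ | memTnInt3 n σ → σ ∈ PsolN n u}) (interior {σ | σ ∉ PsolN n u})
    isOpen_interior isOpen_interior (by
      intro τ hτ
      by_cases hP : τ ∈ PsolN n u
      · left
        rw [mem_interior_iff_mem_nhds]
        exact open_part hu (hsub hτ).2 hP
      · right
        rw [mem_interior_iff_mem_nhds]
        exact closed_part hu1 (hsub hτ).1 hP)
    (by
      rw [Set.eq_empty_iff_forall_notMem]
      rintro τ ⟨hτ, h1, h2⟩
      exact (interior_subset h2 : τ ∉ PsolN n u) ((interior_subset h1 : memTnInt3 n τ → τ ∈ PsolN n u) (hsub hτ).1))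
  rcases key with h | h
  · left
    intro τ hτ
    exact (interior_subset (h hτ) : memTnInt3 n τ → τ ∈ PsolN n u) (hsub hτ).1
  · right
    rw [Set.eq_empty_iff_forall_notMem]
    rintro τ ⟨hτ, h1⟩
    exact (interior_subset (h hτ) : τ ∉ PsolN n u) h1
end
end

section
/- Layers of the reducible walls: Define (all intersected with 𝒯³): P₄πʳᵉᵈ = Σ₄π ∪ {H₂₂₂ = −4π} ∪ ⋃_{(i,j,k) ∈ {1,2}³, (i,j,k) ≠ (2,2,2)} {H_{ijk} = 2π, σ_{ī j̄ k̄} ≤ 2π}; P₆πʳᵉᵈ = Σ₆π ∪ ⋃_{(i,j,k) ∈ {(2,2,2),(2,2,1),(2,1,2),(1,2,2)}} {H_{ijk} = 0, σ_{ī j̄ k̄} ≥ 4π} ∪ ⋃_{(i,j,k) ∈ {(1,1,1),(1,1,2),(1,2,1),(2,1,1)}} {H_{ijk} = 6π, σ_{ī j̄ k̄} ≤ 2π}; P₈πʳᵉᵈ = Σ₈π ∪ {H₁₁₁ = 10π} ∪ ⋃_{(i,j,k) ∈ {1,2}³, (i,j,k) ≠ (1,1,1)} {H_{ijk} = 4π,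 σ_{ī j̄ k̄} ≥ 4π}. Then 𝒫_ωʳᵉᵈ ∩ (𝒯°)³ = P₄πʳᵉᵈ ∩ (𝒯°)³, 𝒫₁ʳᵉᵈ ∩ (𝒯°)³ = P₆πʳᵉᵈ ∩ (𝒯°)³, and 𝒫_{ω²}ʳᵉᵈ ∩ (𝒯°)³ = P₈πʳᵉᵈ ∩ (𝒯°)³. -/
open Real Matrix Set

noncomputable section

abbrev Pt : Type := ℝ × ℝ
abbrev Tri : Type := Pt × Pt × Pt

/-- Membership in `𝒯 = {(a₁,a₂) ∈ [0,2π)² : a₁ ≥ a₂}`. -/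
def memT (p : Pt) : Prop :=
  0 ≤ p.1 ∧ p.1 < 2 * π ∧ 0 ≤ p.2 ∧ p.2 < 2 * π ∧ p.2 ≤ p.1

def memT3 (τ : Tri) : Prop := memT τ.1 ∧ memT τ.2.1 ∧ memT τ.2.2

/-- Membership in the interior `𝒯° = {(a₁,a₂) : 0 < a₂ < a₁ < 2π}`. -/
def memTo (p : Pt) : Prop := 0 < p.2 ∧ p.2 < p.1 ∧ p.1 < 2 * π

def memTo3 (τ : Tri) : Prop := memTo τ.1 ∧ memTo τ.2.1 ∧ memTo τ.2.2

/-- The sum `S(τ) = α₁+α₂+β₁+β₂+γ₁+γ₂`. -/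
def Sf (τ : Tri) : ℝ := τ.1.1 + τ.1.2 + τ.2.1.1 + τ.2.1.2 + τ.2.2.1 + τ.2.2.2

/-- The coordinate of a pair: index `0` is the first coordinate (subscript 1),
index `1` the second (subscript 2). -/
def coord (p : Pt) (i : Fin 2) : ℝ := if i = 0 then p.1 else p.2

/-- `sg τ i j k = σ_{(i+1)(j+1)(k+1)}(τ) = α_i + β_j + γ_k` (indices in `Fin 2`,
index `0` ↔ subscript 1, index `1` ↔ subscript 2). -/
def sg (τ : Tri) (i j k : Fin 2) : ℝ := coord τ.1 i + coord τ.2.1 j + coord τ.2.2 k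

/-- `Hf τ i j k = 2 σ_{ijk}(τ) − σ_{ī j̄ k̄}(τ)`, the complementary index being `i+1` in `Fin 2`. -/
def Hf (τ : Tri) (i j k : Fin 2) : ℝ := 2 * sg τ i j k - sg τ (i + 1) (j + 1) (k + 1)

/-- The spherical reducible wall Σ₄π. -/
def Sig4 : Set Tri := {τ | memT3 τ ∧ Sf τ = 4 * π ∧ sg τ 0 0 0 ≤ 4 * π ∧
  sg τ 0 1 1 ≤ 2 * π ∧ sg τ 1 0 1 ≤ 2 * π ∧ sg τ 1 1 0 ≤ 2 * π}

/-- The spherical reducible wall Σ₆π. -/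
def Sig6 : Set Tri := {τ | memT3 τ ∧ Sf τ = 6 * π ∧ sg τ 1 1 1 ≤ 2 * π ∧
  sg τ 0 0 1 ≤ 4 * π ∧ sg τ 0 1 0 ≤ 4 * π ∧ sg τ 1 0 0 ≤ 4 * π}

/-- The spherical reducible wall Σ₈π. -/
def Sig8 : Set Tri := {τ | memT3 τ ∧ Sf τ = 8 * π ∧ sg τ 0 0 0 ≤ 6 * π ∧
  sg τ 0 1 1 ≤ 4 * π ∧ sg τ 1 0 1 ≤ 4 * π ∧ sg τ 1 1 0 ≤ 4 * π}

abbrev M3 : Type := Matrix (Fin 3) (Fin 3) ℂ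

/-- The form J = diag(1, 1, −1). -/
def J3 : M3 := Matrix.diagonal ![1, 1, -1]

/-- Membership in U(2,1). -/
def memU21 (M : M3) : Prop := Mᴴ * J3 * M = J3

/-- The diagonal matrix E(a₁,a₂) = diag(e^{ia₁}, e^{ia₂}, 1). -/
def Emat (a₁ a₂ : ℝ) : M3 :=
  Matrix.diagonal ![Complex.exp (a₁ * Complex.I), Complex.exp (a₂ * Complex.I), 1]

/-- `M` is of elliptic type `(a₁,a₂)`: conjugate in U(2,1) to E(a₁,a₂). -/
def ellType (M : M3) (a₁ a₂ : ℝ) : Prop :=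
  ∃ P : M3, memU21 P ∧ M = P * Emat a₁ a₂ * P⁻¹

/-- The standard lift L(a₁,a₂) = diag(e^{i(2a₁−a₂)/3}, e^{i(2a₂−a₁)/3}, e^{−i(a₁+a₂)/3}). -/
def Lmat (a₁ a₂ : ℝ) : M3 :=
  Matrix.diagonal ![Complex.exp (((2 * a₁ - a₂) / 3) * Complex.I),
    Complex.exp (((2 * a₂ - a₁) / 3) * Complex.I),
    Complex.exp ((-(a₁ + a₂) / 3) * Complex.I)]

/-- ω = e^{2πi/3}. -/
def omg : ℂ := Complex.exp (2 * π * Complex.I / 3)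

/-- `𝒫ᵤ`: the solution set with standard lifts multiplying to `u·I₃`. -/
def Psol (u : ℂ) : Set Tri := {τ | memT3 τ ∧ ∃ A B C : M3,
  memU21 A ∧ memU21 B ∧ memU21 C ∧
  (∃ P : M3, memU21 P ∧ A = P * Lmat τ.1.1 τ.1.2 * P⁻¹) ∧
  (∃ P : M3, memU21 P ∧ B = P * Lmat τ.2.1.1 τ.2.1.2 * P⁻¹) ∧
  (∃ P : M3, memU21 P ∧ C = P * Lmat τ.2.2.1 τ.2.2.2 * P⁻¹) ∧
  A * B * C = u • (1 : M3)}

/-- `𝒫ᵤʳᵉᵈ`: reducible solutions with standard lifts multiplying to `u·I₃`. -/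
def PsolRed (u : ℂ) : Set Tri := {τ | memT3 τ ∧ ∃ A B C : M3,
  memU21 A ∧ memU21 B ∧ memU21 C ∧
  (∃ P : M3, memU21 P ∧ A = P * Lmat τ.1.1 τ.1.2 * P⁻¹) ∧
  (∃ P : M3, memU21 P ∧ B = P * Lmat τ.2.1.1 τ.2.1.2 * P⁻¹) ∧
  (∃ P : M3, memU21 P ∧ C = P * Lmat τ.2.2.1 τ.2.2.2 * P⁻¹) ∧
  A * B * C = u • (1 : M3) ∧
  ∃ W : Submodule ℂ (Fin 3 → ℂ), W ≠ ⊥ ∧ W ≠ ⊤ ∧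
    (∀ w ∈ W, A.mulVec w ∈ W) ∧ (∀ w ∈ W, B.mulVec w ∈ W) ∧ (∀ w ∈ W, C.mulVec w ∈ W)}

/-- The reducible walls P₄πʳᵉᵈ (index `0` ↔ subscript 1, index `1` ↔ subscript 2). -/
def P4red : Set Tri := {τ | memT3 τ ∧ (τ ∈ Sig4 ∨ Hf τ 1 1 1 = -(4 * π) ∨
  ∃ i j k : Fin 2, ¬(i = 1 ∧ j = 1 ∧ k = 1) ∧
    Hf τ i j k = 2 * π ∧ sg τ (i + 1) (j + 1) (k + 1) ≤ 2 * π)}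

/-- The reducible walls P₆πʳᵉᵈ. -/
def P6red : Set Tri := {τ | memT3 τ ∧ (τ ∈ Sig6 ∨
  (∃ i j k : Fin 2,
    ((i, j, k) = ((1 : Fin 2), (1 : Fin 2), (1 : Fin 2)) ∨ (i, j, k) = (1, 1, 0) ∨
      (i, j, k) = (1, 0, 1) ∨ (i, j, k) = (0, 1, 1)) ∧
    Hf τ i j k = 0 ∧ 4 * π ≤ sg τ (i + 1) (j + 1) (k + 1)) ∨
  (∃ i j k : Fin 2,
    ((i, j, k) = ((0 : Fin 2), (0 : Fin 2), (0 : Fin 2)) ∨ (i, j, k) = (0, 0, 1) ∨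
      (i, j, k) = (0, 1, 0) ∨ (i, j, k) = (1, 0, 0)) ∧
    Hf τ i j k = 6 * π ∧ sg τ (i + 1) (j + 1) (k + 1) ≤ 2 * π))}

/-- The reducible walls P₈πʳᵉᵈ. -/
def P8red : Set Tri := {τ | memT3 τ ∧ (τ ∈ Sig8 ∨ Hf τ 0 0 0 = 10 * π ∨
  ∃ i j k : Fin 2, ¬(i = 0 ∧ j = 0 ∧ k = 0) ∧
    Hf τ i j k = 4 * π ∧ 4 * π ≤ sg τ (i + 1) (j + 1) (k + 1))}


/-- Real form of the two-by-two condition. -/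
def CondR (s ε a b c : ℝ) : Prop :=
  ∃ x y : ℝ, -1 ≤ x ∧ 0 ≤ s * (1 - x) ∧ -1 ≤ y ∧ 0 ≤ s * (1 - y) ∧
    cos a * cos b - x * (sin a * sin b) = ε * cos c ∧
    sin a * cos b + x * (cos a * sin b) = -(ε * (y * sin c))

/-- Comparison of angles through cosines. -/
lemma le_abs_of_cos {c d : ℝ} (hcπ : c ≤ π)
    (h : cos d ≤ cos c) : c ≤ |d| := by
  by_contra hlt
  push Not at hlt
  have := Real.cos_lt_cos_of_nonneg_of_le_pi (abs_nonneg d) hcπ hlt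
  rw [Real.cos_abs] at this
  linarith

lemma abs_le_of_cos {c d : ℝ} (hc0 : 0 ≤ c) (hd : |d| ≤ π)
    (h : cos c ≤ cos d) : |d| ≤ c := by
  by_contra hlt
  push Not at hlt
  have := Real.cos_lt_cos_of_nonneg_of_le_pi hc0 hd hlt
  rw [Real.cos_abs] at this
  linarith

lemma cos_le_of_abs {c d : ℝ} (hcπ : c ≤ π) (h : |d| ≤ c) : cos c ≤ cos d := by
  rw [← Real.cos_abs d]
  exact Real.cos_le_cos_of_nonneg_of_le_pi (abs_nonneg d) hcπ h


lemma hyp_neg {a b c : ℝ} (ha : 0 < a) (ha' : a < π) (hb : 0 < b)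
    (hb' : b < π) (hc : 0 < c) (hc' : c < π) : CondR (-1) (-1) a b c ↔ a + b + c ≤ π := by
  have sa := Real.sin_pos_of_pos_of_lt_pi ha ha'
  have sb := Real.sin_pos_of_pos_of_lt_pi hb hb'
  have sc := Real.sin_pos_of_pos_of_lt_pi hc hc'
  constructor
  · rintro ⟨x, y, -, hx, -, hy, h1, h2⟩
    have hx1 : 1 ≤ x := by linarith
    have hy1 : 1 ≤ y := by linarith
    have e1 : cos (π - (a + b)) ≤ cos c := by
      rw [Real.cos_pi_sub, Real.cos_add]
      nlinarith [mul_pos sa sb]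
    have e3 : y * (sin c * sin a) = cos b + cos a * cos c := by
      have := Real.sin_sq_add_cos_sq a
      have h3 : cos c = x * (sin a * sin b) - cos a * cos b := by linarith
      have h4 : y * sin c = sin a * cos b + x * (cos a * sin b) := by linarith
      rw [h3, ← mul_assoc, h4]
      linear_combination (cos b) * this
    have e2 : cos (π - (a + c)) ≤ cos b := by
      rw [Real.cos_pi_sub, Real.cos_add]
      nlinarith [mul_pos sa sc]
    have f1 := le_abs_of_cos hc'.le e1
    have f2 := le_abs_of_cos hb'.le e2
    rcases abs_cases (π - (a + b)) with ⟨h, _⟩ | ⟨h, _⟩ <;>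
    rcases abs_cases (π - (a + c)) with ⟨h', _⟩ | ⟨h', _⟩ <;> rw [h] at f1 <;> rw [h'] at f2 <;>
      linarith
  · intro h
    have e1 : cos (π - (a + b)) ≤ cos c := 
      Real.cos_le_cos_of_nonneg_of_le_pi hc.le (by linarith) (by linarith)
    have e2 : cos (π - (a + c)) ≤ cos b := 
      Real.cos_le_cos_of_nonneg_of_le_pi hb.le (by linarith) (by linarith)
    rw [Real.cos_pi_sub, Real.cos_add] at e1 e2
    have hx : 1 ≤ (cos c + cos a * cos b) / (sin a * sin b) := by
      rw [le_div_iff₀ (mul_pos sa sb)]; linarith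
    have hy : 1 ≤ (cos b + cos a * cos c) / (sin a * sin c) := by
      rw [le_div_iff₀ (mul_pos sa sc)]; linarith
    refine ⟨(cos c + cos a * cos b) / (sin a * sin b), (cos b + cos a * cos c) / (sin a * sin c),
      by linarith, by linarith, by linarith, by linarith, ?_, ?_⟩
    · field_simp; ring
    · have := Real.sin_sq_add_cos_sq a
      field_simp
      linear_combination (cos b) * this

lemma condR_flip {a b c : ℝ} {s : ℝ} {ε : ℝ} (h : CondR s ε a b c) :
    CondR s (-ε) (π - a) (π - b) (π - c) := by
  obtain ⟨x, y, h1, h2, h3, h4, h5, h6⟩ := h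
  refine ⟨x, y, h1, h2, h3, h4, ?_, ?_⟩
  · simp only [Real.cos_pi_sub, Real.sin_pi_sub]; linarith
  · simp only [Real.cos_pi_sub, Real.sin_pi_sub]; linarith

lemma hyp_pos {a b c : ℝ} (ha : 0 < a) (ha' : a < π) (hb : 0 < b)
    (hb' : b < π) (hc : 0 < c) (hc' : c < π) : CondR (-1) 1 a b c ↔ 2 * π ≤ a + b + c := by
  constructor
  · intro h
    have := condR_flip h
    rw [hyp_neg (by linarith) (by linarith) (by linarith) (by linarith) (by linarith)
      (by linarith)] at this
    linarith
  · intro h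
    have : CondR (-1) (-1) (π - a) (π - b) (π - c) := by
      rw [hyp_neg (by linarith) (by linarith) (by linarith) (by linarith) (by linarith)
        (by linarith)]
      linarith
    have := condR_flip this
    simpa using this

lemma sph_pos {a b c : ℝ} (ha : 0 < a) (ha' : a < π) (hb : 0 < b)
    (hb' : b < π) (hc : 0 < c) (hc' : c < π) : CondR 1 1 a b c ↔ a ≤ b + c ∧ b ≤ a + c ∧ c ≤ a + b ∧ a + b + c ≤ 2 * π := by
  have sa := Real.sin_pos_of_pos_of_lt_pi ha ha'
  have sb := Real.sin_pos_of_pos_of_lt_pi hb hb'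
  have sc := Real.sin_pos_of_pos_of_lt_pi hc hc'
  constructor
  · rintro ⟨x, y, hx, hx', -, -, h1, -⟩
    have e1 : cos c ≤ cos (a - b) := by
      rw [Real.cos_sub]; nlinarith [mul_pos sa sb]
    have f1 := abs_le_of_cos hc.le (by rw [abs_le]; constructor <;> linarith) e1
    have e3 : cos (π - c) ≤ cos (π - (a + b)) := by
      rw [Real.cos_pi_sub, Real.cos_pi_sub, Real.cos_add]; nlinarith [mul_pos sa sb]
    have f2 := abs_le_of_cos (by linarith) (by rw [abs_le]; constructor <;> linarith) e3
    rw [abs_le] at f1 f2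
    refine ⟨?_, ?_, ?_, ?_⟩ <;> linarith
  · rintro ⟨h1, h2, h3, h4⟩
    have e1 : cos c ≤ cos (a - b) :=
      cos_le_of_abs hc'.le (by rw [abs_le]; constructor <;> linarith)
    have e3 : cos (π - c) ≤ cos (π - (a + b)) :=
      cos_le_of_abs (by linarith) (by rw [abs_le]; constructor <;> linarith)
    rw [Real.cos_pi_sub, Real.cos_pi_sub, Real.cos_add] at e3
    rw [Real.cos_sub] at e1
    obtain ⟨x, hxd⟩ : ∃ x, x = (cos a * cos b - cos c) / (sin a * sin b) := ⟨_, rfl⟩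
    have hx : -1 ≤ x := by
      rw [hxd, le_div_iff₀ (mul_pos sa sb)]; linarith
    have hx' : x ≤ 1 := by
      rw [hxd, div_le_iff₀ (mul_pos sa sb)]; linarith
    have hxe : cos a * cos b - x * (sin a * sin b) = cos c := by
      rw [hxd]; field_simp; ring
    obtain ⟨y, hyd⟩ : ∃ y, y = -(sin a * cos b + x * (cos a * sin b)) / sin c := ⟨_, rfl⟩
    have hye : sin a * cos b + x * (cos a * sin b) = -(y * sin c) := by
      rw [hyd]; field_simp
    have hyy : y ^ 2 ≤ 1 := by
      have pa := Real.sin_sq_add_cos_sq a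
      have pb := Real.sin_sq_add_cos_sq b
      have pc := Real.sin_sq_add_cos_sq c
      have : cos c ^ 2 + (y * sin c) ^ 2 = cos b ^ 2 + x ^ 2 * sin b ^ 2 := by
        have : (y * sin c) ^ 2 = (sin a * cos b + x * (cos a * sin b)) ^ 2 := by rw [hye]; ring
        rw [this, ← hxe]
        linear_combination (cos b ^ 2 + x ^ 2 * sin b ^ 2) * pa
      have hx2 : x ^ 2 ≤ 1 := by nlinarith
      have : (y * sin c) ^ 2 ≤ sin c ^ 2 := by nlinarith [sq_nonneg (sin b)]
      have h5 : 0 < sin c ^ 2 := by positivity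
      rw [mul_pow] at this
      nlinarith
    have := abs_le_of_sq_le_sq' (a := y) (b := 1) (by simpa using hyy) (by norm_num)
    exact ⟨x, y, hx, by linarith, this.1, by linarith [this.2], by linarith, by linarith⟩

lemma sph_neg {a b c : ℝ} (ha : 0 < a) (ha' : a < π) (hb : 0 < b)
    (hb' : b < π) (hc : 0 < c) (hc' : c < π) : CondR 1 (-1) a b c ↔
    π ≤ a + b + c ∧ a + b - c ≤ π ∧ a + c - b ≤ π ∧ b + c - a ≤ π := by
  have key : CondR 1 (-1) a b c ↔ CondR 1 1 a b (π - c) := by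
    constructor
    · rintro ⟨x, y, hx, hx', hy, hy', h1, h2⟩
      refine ⟨x, -y, hx, hx', by linarith, by linarith, ?_, ?_⟩ <;>
        simp only [Real.cos_pi_sub, Real.sin_pi_sub] <;> linarith
    · rintro ⟨x, y, hx, hx', hy, hy', h1, h2⟩
      simp only [Real.cos_pi_sub, Real.sin_pi_sub] at h1 h2
      refine ⟨x, -y, hx, hx', by linarith, by linarith, ?_, ?_⟩ <;> linarith
  rw [key, sph_pos ha ha' hb hb' (by linarith) (by linarith)]
  constructor
  · rintro ⟨h1, h2, h3, h4⟩
    refine ⟨?_, ?_, ?_, ?_⟩ <;> linarith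
  · rintro ⟨h1, h2, h3, h4⟩
    refine ⟨?_, ?_, ?_, ?_⟩ <;> linarith


abbrev M2 : Type := Matrix (Fin 2) (Fin 2) ℂ

/-- `exp (i t)`. -/
def ex (t : ℝ) : ℂ := Complex.exp (t * Complex.I)

lemma ex_add (x y : ℝ) : ex (x + y) = ex x * ex y := by
  simp [ex, add_mul, Complex.exp_add]

lemma ex_zero : ex 0 = 1 := by simp [ex]

lemma ex_neg_mul (x : ℝ) : ex (-x) * ex x = 1 := by rw [← ex_add]; simp [ex_zero]

lemma ex_mul_neg (x : ℝ) : ex x * ex (-x) = 1 := by rw [← ex_add]; simp [ex_zero]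

lemma ex_ne (x : ℝ) : ex x ≠ 0 := Complex.exp_ne_zero _

lemma ex_conj (x : ℝ) : (starRingEnd ℂ) (ex x) = ex (-x) := by
  simp [ex, ← Complex.exp_conj]

lemma ex_eq (x : ℝ) : ex x = (cos x : ℂ) + (sin x : ℂ) * Complex.I := by
  rw [ex, Complex.exp_mul_I]; simp

lemma ex_re (x : ℝ) : (ex x).re = cos x := by simp [ex, Complex.exp_ofReal_mul_I_re]
lemma ex_im (x : ℝ) : (ex x).im = sin x := by simp [ex, Complex.exp_ofReal_mul_I_im]

lemma ex_eq_iff (x y : ℝ) : ex x = ex y ↔ ∃ n : ℤ, x = y + n * (2 * π) := by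
  unfold ex
  rw [Complex.exp_eq_exp_iff_exists_int]
  constructor
  · rintro ⟨n, hn⟩
    refine ⟨n, ?_⟩
    have h2 : ((x : ℂ)) * Complex.I = ((y + n * (2 * π) : ℝ) : ℂ) * Complex.I := by
      rw [hn]; push_cast; ring
    exact_mod_cast mul_right_cancel₀ Complex.I_ne_zero h2
  · rintro ⟨n, hn⟩
    refine ⟨n, ?_⟩
    rw [hn]; push_cast; ring

def D2 (a : ℝ) : M2 := !![ex a, 0; 0, ex (-a)]
def J2 (s : ℝ) : M2 := !![1, 0; 0, (s : ℂ)]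

/-- the real rotation/boost. -/
def R2 (s p q : ℝ) : M2 := !![(p : ℂ), -(s * q : ℂ); (q : ℂ), (p : ℂ)]

lemma D2_neg_mul (a : ℝ) : D2 a * D2 (-a) = 1 := by
  simp [D2, Matrix.one_fin_two, ex_mul_neg, ex_neg_mul]

lemma J2_mul (s : ℝ) (hs : s * s = 1) : J2 s * J2 s = 1 := by
  have : (s : ℂ) * s = 1 := by exact_mod_cast hs
  simp [J2, Matrix.one_fin_two, this]

lemma adj2 (s : ℝ) (hs : s * s = 1) (T : M2) : J2 s * Tᴴ * J2 s =
    !![(starRingEnd ℂ) (T 0 0), s * (starRingEnd ℂ) (T 1 0);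
      s * (starRingEnd ℂ) (T 0 1), (starRingEnd ℂ) (T 1 1)] := by
  have hsC : (s : ℂ) * s = 1 := by exact_mod_cast hs
  rw [Matrix.eta_fin_two Tᴴ, J2]
  simp only [Matrix.mul_fin_two, Matrix.conjTranspose_apply, RCLike.star_def]
  ext i j
  fin_cases i <;> fin_cases j <;> simp
  · ring
  · linear_combination (starRingEnd ℂ) (T 1 1) * hsC

/-- Forward two-by-two lemma. -/
lemma cond_of_prod {s ε a b c : ℝ} (hs : s * s = 1) {R Q : M2}
    (hR : Rᴴ * J2 s * R = J2 s) (hQ : Qᴴ * J2 s * Q = J2 s)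
    (h : D2 a * (R * D2 b * (J2 s * Rᴴ * J2 s)) * (Q * D2 c * (J2 s * Qᴴ * J2 s))
      = (ε : ℂ) • (1 : M2)) : CondR s ε a b c := by
  have hJ := J2_mul s hs
  have inv : ∀ T : M2, Tᴴ * J2 s * T = J2 s → T * (J2 s * Tᴴ * J2 s) = 1 ∧
      (J2 s * Tᴴ * J2 s) * T = 1 := by
    intro T hT
    have : (J2 s * Tᴴ * J2 s) * T = 1 := by
      calc (J2 s * Tᴴ * J2 s) * T = J2 s * (Tᴴ * J2 s * T) := by simp only [Matrix.mul_assoc]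
        _ = 1 := by rw [hT, hJ]
    exact ⟨mul_eq_one_comm.mp this, this⟩
  obtain ⟨hR1, hR2⟩ := inv R hR
  obtain ⟨hQ1, hQ2⟩ := inv Q hQ
  have h2 : D2 a * (R * D2 b * (J2 s * Rᴴ * J2 s)) =
      (ε : ℂ) • (Q * D2 (-c) * (J2 s * Qᴴ * J2 s)) := by
    have h3 : (Q * D2 c * (J2 s * Qᴴ * J2 s)) * (Q * D2 (-c) * (J2 s * Qᴴ * J2 s)) = 1 := by
      calc _ = Q * (D2 c * (((J2 s * Qᴴ * J2 s) * Q) * D2 (-c))) * (J2 s * Qᴴ * J2 s) := by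
            simp only [Matrix.mul_assoc]
        _ = 1 := by rw [hQ2, Matrix.one_mul, D2_neg_mul, Matrix.mul_one, hQ1]
    have h4 := congrArg (· * (Q * D2 (-c) * (J2 s * Qᴴ * J2 s))) h
    simp only [Matrix.mul_assoc _ (Q * D2 c * (J2 s * Qᴴ * J2 s)), h3, Matrix.mul_one,
      Matrix.smul_mul, Matrix.one_mul] at h4
    exact h4
  have hsC : (s : ℂ) * s = 1 := by exact_mod_cast hs
  have nrm : ∀ T : M2, T * (J2 s * Tᴴ * J2 s) = 1 →
      Complex.normSq (T 0 0) + s * Complex.normSq (T 0 1) = 1 := by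
    intro T hT
    have := congrFun (congrFun hT 0) 0
    rw [adj2 s hs] at this
    simp [Matrix.mul_apply, Fin.sum_univ_two] at this
    have e : ((Complex.normSq (T 0 0) + s * Complex.normSq (T 0 1) : ℝ) : ℂ) = 1 := by
      push_cast
      rw [← Complex.mul_conj, ← Complex.mul_conj]
      linear_combination this
    exact_mod_cast e
  have n1 := nrm R hR1
  have n2 := nrm Q hQ1
  have h5 := congrFun (congrFun h2 0) 0
  rw [adj2 s hs, adj2 s hs] at h5
  simp [Matrix.mul_apply, Fin.sum_univ_two, D2] at h5
  have h6 : ex a * ((Complex.normSq (R 0 0) : ℂ) * ex b +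
        (1 - Complex.normSq (R 0 0) : ℂ) * ex (-b))
      = ε * ((Complex.normSq (Q 0 0) : ℂ) * ex (-c) +
        (1 - Complex.normSq (Q 0 0) : ℂ) * ex c) := by
    have n1' : (1 - Complex.normSq (R 0 0) : ℂ) = s * Complex.normSq (R 0 1) := by
      have : (1 - Complex.normSq (R 0 0)) = s * Complex.normSq (R 0 1) := by linarith
      exact_mod_cast this
    have n2' : (1 - Complex.normSq (Q 0 0) : ℂ) = s * Complex.normSq (Q 0 1) := by
      have : (1 - Complex.normSq (Q 0 0)) = s * Complex.normSq (Q 0 1) := by linarith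
      exact_mod_cast this
    rw [n1', n2', ← Complex.mul_conj, ← Complex.mul_conj, ← Complex.mul_conj, ← Complex.mul_conj]
    linear_combination h5
  have hs2 : ∀ t : ℝ, s * (s * t) = t := fun t => by rw [← mul_assoc, hs, one_mul]
  have x1 : 0 ≤ s * (1 - Complex.normSq (R 0 0)) := by
    rw [show 1 - Complex.normSq (R 0 0) = s * Complex.normSq (R 0 1) by linarith, hs2]
    exact Complex.normSq_nonneg _
  have y1 : 0 ≤ s * (1 - Complex.normSq (Q 0 0)) := by
    rw [show 1 - Complex.normSq (Q 0 0) = s * Complex.normSq (Q 0 1) by linarith, hs2]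
    exact Complex.normSq_nonneg _
  have x0 := Complex.normSq_nonneg (R 0 0)
  have y0 := Complex.normSq_nonneg (Q 0 0)
  generalize Complex.normSq (Q 0 0) = Y at *
  generalize Complex.normSq (R 0 0) = X at *
  refine ⟨2 * X - 1, 2 * Y - 1, by linarith, by linarith, by linarith, by linarith, ?_, ?_⟩
  · have := congrArg Complex.re h6
    simp [ex_re, ex_im] at this
    linarith
  · have := congrArg Complex.im h6
    simp [ex_re, ex_im] at this
    linarith

lemma R2_mem {s p q : ℝ} (hs : s * s = 1) (h : p ^ 2 + s * q ^ 2 = 1) :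
    (R2 s p q)ᴴ * J2 s * R2 s p q = J2 s := by
  have hsC : (s : ℂ) * s = 1 := by exact_mod_cast hs
  have hC : (p : ℂ) ^ 2 + s * q ^ 2 = 1 := by exact_mod_cast h
  rw [Matrix.eta_fin_two (R2 s p q)ᴴ]
  simp only [R2, J2, Matrix.mul_fin_two, Matrix.conjTranspose_apply, RCLike.star_def]
  ext i j
  fin_cases i <;> fin_cases j <;> simp
  · linear_combination hC
  · ring
  · ring
  · linear_combination s * hC

lemma R2_inv {s p q : ℝ} (hs : s * s = 1) (h : p ^ 2 + s * q ^ 2 = 1) :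
    R2 s p q * !![(p : ℂ), (s * q : ℂ); -(q : ℂ), (p : ℂ)] = 1 := by
  have hsC : (s : ℂ) * s = 1 := by exact_mod_cast hs
  have hC : (p : ℂ) ^ 2 + s * q ^ 2 = 1 := by exact_mod_cast h
  simp only [R2, Matrix.mul_fin_two, Matrix.one_fin_two]
  ext i j
  fin_cases i <;> fin_cases j <;> simp
  · linear_combination hC
  · ring
  · ring
  · linear_combination hC

lemma exists_pq {s x : ℝ} (hs : s * s = 1) (h1 : -1 ≤ x) (h2 : 0 ≤ s * (1 - x)) :
    ∃ p q : ℝ, 0 ≤ p ∧ 0 ≤ q ∧ p ^ 2 = (1 + x) / 2 ∧ s * q ^ 2 = (1 - x) / 2 := by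
  refine ⟨√((1 + x) / 2), √(s * (1 - x) / 2), Real.sqrt_nonneg _, Real.sqrt_nonneg _, ?_, ?_⟩
  · rw [Real.sq_sqrt (by linarith)]
  · rw [Real.sq_sqrt (by linarith)]; linear_combination (1 - x) / 2 * hs

/-- Backward two-by-two lemma. -/
lemma prod_of_cond {s ε a b c : ℝ} (hs : s * s = 1) (hε : ε * ε = 1) (sb : 0 < sin b)
    (sc : 0 < sin c)
    (h : CondR s ε a b c) : ∃ R Q R' Q' : M2, Rᴴ * J2 s * R = J2 s ∧ Qᴴ * J2 s * Q = J2 s ∧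
      R * R' = 1 ∧ Q * Q' = 1 ∧
    D2 a * (R * D2 b * R') * (Q * D2 c * Q') = (ε : ℂ) • (1 : M2) := by
  obtain ⟨x, y, hx, hx', hy, hy', h1, h2⟩ := h
  obtain ⟨p, q, hp0, hq0, hp, hq⟩ := exists_pq hs hx hx'
  obtain ⟨P, Q, hP0, hQ0, hP, hQ⟩ := exists_pq hs hy hy'
  have hpq : p ^ 2 + s * q ^ 2 = 1 := by rw [hp, hq]; ring
  have hPQ : P ^ 2 + s * Q ^ 2 = 1 := by rw [hP, hQ]; ring
  have key : p * q * sin b = P * Q * sin c := by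
    have pa := Real.sin_sq_add_cos_sq a
    have pb := Real.sin_sq_add_cos_sq b
    have pc := Real.sin_sq_add_cos_sq c
    have e1 : cos b ^ 2 + x ^ 2 * sin b ^ 2 = cos c ^ 2 + y ^ 2 * sin c ^ 2 := by
      have : (cos a * cos b - x * (sin a * sin b)) ^ 2 +
        (sin a * cos b + x * (cos a * sin b)) ^ 2 = cos c ^ 2 + y ^ 2 * sin c ^ 2 := by
        rw [h1, h2]; linear_combination (cos c ^ 2 + y ^ 2 * sin c ^ 2) * hε
      rw [← this]
      linear_combination (-(cos b ^ 2 + x ^ 2 * sin b ^ 2)) * pa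
    have e2 : p ^ 2 * (s * q ^ 2) * sin b ^ 2 = P ^ 2 * (s * Q ^ 2) * sin c ^ 2 := by
      rw [hp, hq, hP, hQ]
      linear_combination (-1 / 4) * e1 + pb / 4 - pc / 4
    have e3 : (p * q * sin b) ^ 2 = (P * Q * sin c) ^ 2 := by
      linear_combination s * e2 + ((P * Q * sin c) ^ 2 - (p * q * sin b) ^ 2) * hs
    exact (pow_left_inj₀ (by positivity) (by positivity) (by norm_num)).mp e3
  have hsC : (s : ℂ) * s = 1 := by exact_mod_cast hs
  have hεC : (ε : ℂ) * ε = 1 := by exact_mod_cast hε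
  let F : M2 := !![-(ε : ℂ) * ex a, 0; 0, 1]
  let F' : M2 := !![-(ε : ℂ) * ex (-a), 0; 0, 1]
  have hF : F * F' = 1 := by
    simp only [F, F', Matrix.mul_fin_two, Matrix.one_fin_two]
    ext i j
    fin_cases i <;> fin_cases j <;> simp
    linear_combination hεC * (ex a * ex (-a)) + ex_mul_neg a
  have hFh : Fᴴ = F' := by
    ext i j
    fin_cases i <;> fin_cases j <;> simp [F, F', ex_conj]
  have hFJ : F' * J2 s * F = J2 s := by
    simp only [F, F', J2, Matrix.mul_fin_two]
    ext i j
    fin_cases i <;> fin_cases j <;> simp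
    linear_combination hεC * (ex a * ex (-a)) + ex_mul_neg a
  have sinb : ex b - ex (-b) = 2 * Complex.I * (sin b : ℂ) := by
    rw [ex_eq, ex_eq, Real.sin_neg, Real.cos_neg]; push_cast; ring
  have sinc : ex c - ex (-c) = 2 * Complex.I * (sin c : ℂ) := by
    rw [ex_eq, ex_eq, Real.sin_neg, Real.cos_neg]; push_cast; ring
  have keyC : (p : ℂ) * q * (ex b - ex (-b)) = P * Q * (ex c - ex (-c)) := by
    have : (p : ℂ) * q * (sin b : ℂ) = P * Q * (sin c : ℂ) := by exact_mod_cast key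
    rw [sinb, sinc]; linear_combination 2 * Complex.I * this
  have z1 : ex a * ((p : ℂ) ^ 2 * ex b + s * q ^ 2 * ex (-b))
      = ε * (P ^ 2 * ex (-c) + s * Q ^ 2 * ex c) := by
    have a1 : (p : ℂ) ^ 2 = (1 + x) / 2 := by exact_mod_cast hp
    have a2 : (s : ℂ) * q ^ 2 = (1 - x) / 2 := by exact_mod_cast hq
    have a3 : (P : ℂ) ^ 2 = (1 + y) / 2 := by exact_mod_cast hP
    have a4 : (s : ℂ) * Q ^ 2 = (1 - y) / 2 := by exact_mod_cast hQ
    rw [a1, a2, a3, a4]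
    simp only [ex_eq, Real.sin_neg, Real.cos_neg]
    have c1 : (cos a : ℂ) * cos b - x * (sin a * sin b) = ε * cos c := by exact_mod_cast h1
    have c2 : (sin a : ℂ) * cos b + x * (cos a * sin b) = -(ε * (y * sin c)) := by
      exact_mod_cast h2
    push_cast at c1 c2 ⊢
    linear_combination c1 + Complex.I * c2 + (Complex.sin a * Complex.sin b * x) * Complex.I_sq
  have z2 : ex (-a) * (s * (q : ℂ) ^ 2 * ex b + p ^ 2 * ex (-b))
      = ε * (s * Q ^ 2 * ex (-c) + P ^ 2 * ex c) := by
    have := congrArg (starRingEnd ℂ) z1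
    simp [ex_conj] at this
    linear_combination this
  let S' : M2 := !![(P : ℂ), (s * Q : ℂ); -(Q : ℂ), (P : ℂ)]
  have hS : R2 s P Q * S' = 1 := R2_inv hs hPQ
  have hQQ : (F * R2 s P Q) * (S' * F') = 1 := by
    rw [Matrix.mul_assoc, ← Matrix.mul_assoc _ S', hS, Matrix.one_mul, hF]
  refine ⟨R2 s p q, F * R2 s P Q, _, S' * F', R2_mem hs hpq, ?_, R2_inv hs hpq, hQQ, ?_⟩
  · rw [Matrix.conjTranspose_mul, hFh]
    calc _ = (R2 s P Q)ᴴ * (F' * J2 s * F) * R2 s P Q := by simp only [Matrix.mul_assoc]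
      _ = _ := by rw [hFJ, R2_mem hs hPQ]
  · have main : D2 a * (R2 s p q * D2 b * !![(p : ℂ), (s * q : ℂ); -(q : ℂ), (p : ℂ)]) =
        (ε : ℂ) • (F * R2 s P Q * D2 (-c) * (S' * F')) := by
      simp only [F, F', S', R2, D2, Matrix.mul_fin_two]
      ext i j
      fin_cases i <;> fin_cases j <;> simp
      · linear_combination z1 - (ε * (P ^ 2 * ex (-c) + s * Q ^ 2 * ex c)) *
          (hεC * (ex a * ex (-a)) + ex_mul_neg a)
      · linear_combination s * ex a * keyC - s * ex a * (P * Q * (ex c - ex (-c))) * hεC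
      · linear_combination ex (-a) * keyC - ex (-a) * (P * Q * (ex c - ex (-c))) * hεC
      · linear_combination z2
    rw [main]
    have hQQ' := mul_eq_one_comm.mp hQQ
    rw [Matrix.smul_mul]
    congr 1
    calc _ = F * R2 s P Q * (D2 (-c) * (((S' * F') * (F * R2 s P Q)) * D2 c)) * (S' * F') := by
          simp only [Matrix.mul_assoc]
      _ = 1 := by
          have := D2_neg_mul (-c)
          rw [neg_neg] at this
          rw [hQQ', Matrix.one_mul, this, Matrix.mul_one, hQQ]

/-- Block embedding. `true`: the fixed line is negative (index 2); `false`: positive (index 0). -/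
def emb (n : Bool) (t : ℂ) (M : M2) : M3 :=
  if n then !![M 0 0, M 0 1, 0; M 1 0, M 1 1, 0; 0, 0, t]
  else !![t, 0, 0; 0, M 0 0, M 0 1; 0, M 1 0, M 1 1]

def sgn (n : Bool) : ℝ := if n then 1 else -1
def rI (n : Bool) : Fin 3 := if n then 2 else 0

lemma sgn_sq (n : Bool) : sgn n * sgn n = 1 := by cases n <;> simp [sgn]

lemma emb_mul (n : Bool) (t t' : ℂ) (M M' : M2) :
    emb n t M * emb n t' M' = emb n (t * t') (M * M') := by
  cases n <;> ext i j <;> fin_cases i <;> fin_cases j <;>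
    simp [emb, Matrix.mul_apply, Fin.sum_univ_two, Fin.sum_univ_three]

lemma emb_one (n : Bool) : emb n 1 1 = 1 := by
  cases n <;> ext i j <;> fin_cases i <;> fin_cases j <;> simp [emb]

lemma emb_smul_one (n : Bool) (u : ℂ) : u • (1 : M3) = emb n u (u • (1 : M2)) := by
  cases n <;> ext i j <;> fin_cases i <;> fin_cases j <;> simp [emb]

lemma emb_inj {n : Bool} {t t' : ℂ} {M M' : M2} (h : emb n t M = emb n t' M') :
    t = t' ∧ M = M' := by
  have e := fun i j => congrFun (congrFun h i) j
  cases n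
  · refine ⟨by simpa [emb] using e 0 0, ?_⟩
    ext i j
    fin_cases i <;> fin_cases j
    · simpa [emb] using e 1 1
    · simpa [emb] using e 1 2
    · simpa [emb] using e 2 1
    · simpa [emb] using e 2 2
  · refine ⟨by simpa [emb] using e 2 2, ?_⟩
    ext i j
    fin_cases i <;> fin_cases j
    · simpa [emb] using e 0 0
    · simpa [emb] using e 0 1
    · simpa [emb] using e 1 0
    · simpa [emb] using e 1 1

lemma emb_conjTranspose (n : Bool) (t : ℂ) (M : M2) :
    (emb n t M)ᴴ = emb n ((starRingEnd ℂ) t) Mᴴ := by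
  cases n <;> ext i j <;> fin_cases i <;> fin_cases j <;>
    simp [emb, Matrix.conjTranspose_apply]

lemma J3_eq (n : Bool) : J3 = emb n (-(sgn n : ℂ)) (J2 (sgn n)) := by
  cases n <;> ext i j <;> fin_cases i <;> fin_cases j <;>
    simp [emb, sgn, J2, J3]

lemma emb_mem_iff (n : Bool) (t : ℂ) (M : M2) : memU21 (emb n t M) ↔
    (starRingEnd ℂ) t * t = 1 ∧ Mᴴ * J2 (sgn n) * M = J2 (sgn n) := by
  have hs : (sgn n : ℂ) ≠ 0 := by cases n <;> simp [sgn]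
  rw [memU21, J3_eq n, emb_conjTranspose, emb_mul, emb_mul]
  constructor
  · intro h
    obtain ⟨h1, h2⟩ := emb_inj h
    refine ⟨?_, h2⟩
    apply mul_right_cancel₀ hs
    linear_combination -h1
  · rintro ⟨h1, h2⟩
    rw [h2]
    congr 1
    linear_combination -(sgn n : ℂ) * h1

lemma J3_sq : J3 * J3 = 1 := by
  ext i j
  fin_cases i <;> fin_cases j <;> simp [J3]

lemma U_left {M : M3} (h : memU21 M) : (J3 * Mᴴ * J3) * M = 1 := by
  calc (J3 * Mᴴ * J3) * M = J3 * (Mᴴ * J3 * M) := by simp only [Matrix.mul_assoc]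
    _ = 1 := by rw [h, J3_sq]

lemma U_inv {M : M3} (h : memU21 M) : M⁻¹ = J3 * Mᴴ * J3 := Matrix.inv_eq_left_inv (U_left h)

lemma U_mul_inv {M : M3} (h : memU21 M) : M * M⁻¹ = 1 := by
  rw [U_inv h]; exact mul_eq_one_comm.mp (U_left h)

lemma U_inv_mul {M : M3} (h : memU21 M) : M⁻¹ * M = 1 := by
  rw [U_inv h]; exact U_left h

lemma U_mul {M N : M3} (hM : memU21 M) (hN : memU21 N) : memU21 (M * N) := by
  unfold memU21 at *
  rw [Matrix.conjTranspose_mul]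
  calc _ = Nᴴ * (Mᴴ * J3 * M) * N := by simp only [Matrix.mul_assoc]
    _ = J3 := by rw [hM, hN]

lemma U_inv_mem {M : M3} (h : memU21 M) : memU21 M⁻¹ := by
  have h1 := U_mul_inv h
  have h2 : (M⁻¹)ᴴ * Mᴴ = 1 := by rw [← Matrix.conjTranspose_mul, h1, Matrix.conjTranspose_one]
  unfold memU21
  calc (M⁻¹)ᴴ * J3 * M⁻¹ = (M⁻¹)ᴴ * (Mᴴ * J3 * M) * M⁻¹ := by rw [h]
    _ = ((M⁻¹)ᴴ * Mᴴ) * J3 * (M * M⁻¹) := by simp only [Matrix.mul_assoc]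
    _ = J3 := by rw [h1, h2, Matrix.one_mul, Matrix.mul_one]

lemma U_one : memU21 1 := by simp [memU21]

lemma Lmat_N (x y : ℝ) : Lmat x y =
    emb true (ex (-(2 * ((x + y) / 6)))) (ex ((x + y) / 6) • D2 ((x - y) / 2)) := by
  ext i j
  fin_cases i <;> fin_cases j <;> simp [emb, Lmat, D2, ← ex_add] <;>
    simp only [ex] <;> congr 2 <;> push_cast <;> ring

lemma Lmat_P (x y : ℝ) : Lmat x y =
    emb false (ex (-(2 * ((y - 2 * x) / 6)))) (ex ((y - 2 * x) / 6) • D2 (y / 2)) := by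
  ext i j
  fin_cases i <;> fin_cases j <;> simp [emb, Lmat, D2, ← ex_add] <;>
    simp only [ex] <;> congr 2 <;> push_cast <;> ring

lemma Lmat_mem (x y : ℝ) : memU21 (Lmat x y) := by
  have c : ∀ t : ℝ, (starRingEnd ℂ) (ex t) * ex t = 1 := fun t => by
    rw [ex_conj, ex_neg_mul]
  have e : Lmat x y = Matrix.diagonal ![ex ((2 * x - y) / 3), ex ((2 * y - x) / 3),
      ex (-(x + y) / 3)] := by
    simp [Lmat, ex]
  rw [e, memU21, J3, Matrix.diagonal_conjTranspose, Matrix.diagonal_mul_diagonal,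
    Matrix.diagonal_mul_diagonal]
  congr 1
  ext i
  fin_cases i <;> simp [c]

def Cj (A : M3) (x y : ℝ) : Prop := ∃ P : M3, memU21 P ∧ A = P * Lmat x y * P⁻¹

lemma Cj_mem {A : M3} {x y : ℝ} (h : Cj A x y) : memU21 A := by
  obtain ⟨P, hP, rfl⟩ := h
  exact U_mul (U_mul hP (Lmat_mem x y)) (U_inv_mem hP)

def Sw : M3 := !![0, 1, 0; 1, 0, 0; 0, 0, 1]

lemma Sw_mem : memU21 Sw := by
  unfold memU21
  ext i j
  fin_cases i <;> fin_cases j <;>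
    simp [Sw, J3, Matrix.mul_apply, Fin.sum_univ_three, Matrix.conjTranspose_apply]

lemma Sw_sq : Sw * Sw = 1 := by
  ext i j
  fin_cases i <;> fin_cases j <;> simp [Sw, Matrix.mul_apply, Fin.sum_univ_three]

lemma Lmat_eq (x y : ℝ) : Lmat x y = !![Complex.exp (((2 * x - y) / 3) * Complex.I), 0, 0;
    0, Complex.exp (((2 * y - x) / 3) * Complex.I), 0;
    0, 0, Complex.exp ((-(x + y) / 3) * Complex.I)] := by
  ext i j
  fin_cases i <;> fin_cases j <;> simp [Lmat]

lemma Sw_L (x y : ℝ) : Lmat x y = Sw * Lmat y x * Sw⁻¹ := by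
  rw [Matrix.inv_eq_right_inv Sw_sq]
  ext i j
  rw [Lmat_eq, Lmat_eq]
  fin_cases i <;> fin_cases j <;> simp [Sw, Matrix.mul_apply, Fin.sum_univ_three]
  ring_nf

lemma Cj_swap {A : M3} {x y : ℝ} (h : Cj A x y) : Cj A y x := by
  obtain ⟨P, hP, rfl⟩ := h
  refine ⟨P * Sw, U_mul hP Sw_mem, ?_⟩
  rw [Sw_L x y, Matrix.mul_inv_rev]
  simp only [Matrix.mul_assoc]

lemma Cj_coord {A : M3} {p : Pt} (i : Fin 2) : Cj A (coord p i) (coord p (i + 1)) ↔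
    Cj A p.1 p.2 := by
  fin_cases i
  · simp [coord]
  · simp [coord]; exact ⟨Cj_swap, Cj_swap⟩

lemma block {n : Bool} {R : M3} (hR : memU21 R) {t : ℂ} (ht : t ≠ 0)
    (h : R.mulVec (Pi.single (rI n) 1) = t • Pi.single (rI n) 1) : ∃ M, R = emb n t M := by
  have e : ∀ i, R i (rI n) = t * (Pi.single (rI n) 1 : Fin 3 → ℂ) i := by
    intro i
    have := congrFun h i
    simpa using this
  have u := fun i j => congrFun (congrFun hR i) j
  cases n
  · refine ⟨!![R 1 1, R 1 2; R 2 1, R 2 2], ?_⟩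
    have e0 : R 0 0 = t := by simpa [rI] using e 0
    have e1 : R 1 0 = 0 := by simpa [rI] using e 1
    have e2 : R 2 0 = 0 := by simpa [rI] using e 2
    have u1 : R 0 1 = 0 := by
      have := u 0 1
      simp [J3, Matrix.mul_apply, Fin.sum_univ_three, Matrix.conjTranspose_apply, e0, e1, e2] at this
      tauto
    have u2 : R 0 2 = 0 := by
      have := u 0 2
      simp [J3, Matrix.mul_apply, Fin.sum_univ_three, Matrix.conjTranspose_apply, e0, e1, e2] at this
      tauto
    ext i j
    fin_cases i <;> fin_cases j <;> simp [emb, e0, e1, e2, u1, u2]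
  · refine ⟨!![R 0 0, R 0 1; R 1 0, R 1 1], ?_⟩
    have e0 : R 0 2 = 0 := by simpa [rI] using e 0
    have e1 : R 1 2 = 0 := by simpa [rI] using e 1
    have e2 : R 2 2 = t := by simpa [rI] using e 2
    have u1 : R 2 0 = 0 := by
      have := u 2 0
      simp [J3, Matrix.mul_apply, Fin.sum_univ_three, Matrix.conjTranspose_apply, e0, e1, e2] at this
      tauto
    have u2 : R 2 1 = 0 := by
      have := u 2 1
      simp [J3, Matrix.mul_apply, Fin.sum_univ_three, Matrix.conjTranspose_apply, e0, e1, e2] at this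
      tauto
    ext i j
    fin_cases i <;> fin_cases j <;> simp [emb, e0, e1, e2, u1, u2]

lemma emb_inv {n : Bool} {t : ℂ} {M : M2} (h : memU21 (emb n t M)) :
    (emb n t M)⁻¹ = emb n ((starRingEnd ℂ) t) (J2 (sgn n) * Mᴴ * J2 (sgn n)) := by
  have hs : (sgn n : ℂ) * sgn n = 1 := by exact_mod_cast sgn_sq n
  rw [U_inv h, J3_eq n, emb_conjTranspose, emb_mul, emb_mul]
  congr 1
  linear_combination (starRingEnd ℂ) t * hs

lemma forward {n : Bool} {u : ℂ} (hu : u ^ 3 = 1) {mA mB mC a b c : ℝ} {A B C PA PB PC : M3}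
    (hPA : memU21 PA) (hPB : memU21 PB) (hPC : memU21 PC)
    (hA : A = PA * emb n (ex (-(2 * mA))) (ex mA • D2 a) * PA⁻¹)
    (hB : B = PB * emb n (ex (-(2 * mB))) (ex mB • D2 b) * PB⁻¹)
    (hC : C = PC * emb n (ex (-(2 * mC))) (ex mC • D2 c) * PC⁻¹)
    (hABC : A * B * C = u • (1 : M3)) {v : Fin 3 → ℂ} {tA tB tC : ℂ}
    (hA0 : tA ≠ 0) (hB0 : tB ≠ 0) (hC0 : tC ≠ 0)
    (vA : v = PA.mulVec (tA • Pi.single (rI n) 1))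
    (vB : v = PB.mulVec (tB • Pi.single (rI n) 1))
    (vC : v = PC.mulVec (tC • Pi.single (rI n) 1)) :
    ∃ ε : ℝ, ε * ε = 1 ∧ u = ex (-(2 * (mA + mB + mC))) ∧ u = ε * ex (mA + mB + mC) ∧
      CondR (sgn n) ε a b c := by
  have getR : ∀ (P : M3) (tP : ℂ), tP ≠ 0 → v = P.mulVec (tP • Pi.single (rI n) 1) →
      (PA⁻¹ * P).mulVec (Pi.single (rI n) 1) = (tA / tP) • Pi.single (rI n) 1 := by
    intro P tP h0 hv
    have e1 : P.mulVec (Pi.single (rI n) 1) = tP⁻¹ • v := by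
      rw [hv, Matrix.mulVec_smul, smul_smul, inv_mul_cancel₀ h0, one_smul]
    rw [← Matrix.mulVec_mulVec, e1, vA, Matrix.mulVec_smul, Matrix.mulVec_mulVec,
      U_inv_mul hPA, Matrix.one_mulVec, smul_smul]
    congr 1
    field_simp
  have hRm : memU21 (PA⁻¹ * PB) := U_mul (U_inv_mem hPA) hPB
  have hQm : memU21 (PA⁻¹ * PC) := U_mul (U_inv_mem hPA) hPC
  obtain ⟨R, hR⟩ := block hRm (div_ne_zero hA0 hB0) (getR PB tB hB0 vB)
  obtain ⟨Q, hQ⟩ := block hQm (div_ne_zero hA0 hC0) (getR PC tC hC0 vC)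
  rw [hR] at hRm
  rw [hQ] at hQm
  have hRi := emb_inv hRm
  have hQi := emb_inv hQm
  obtain ⟨r1, r2⟩ := (emb_mem_iff _ _ _).mp hRm
  obtain ⟨q1, q2⟩ := (emb_mem_iff _ _ _).mp hQm
  rw [← hR, Matrix.mul_inv_rev, Matrix.nonsing_inv_nonsing_inv _
    (Matrix.isUnit_det_of_left_inverse (U_inv_mul hPA))] at hRi
  rw [← hQ, Matrix.mul_inv_rev, Matrix.nonsing_inv_nonsing_inv _
    (Matrix.isUnit_det_of_left_inverse (U_inv_mul hPA))] at hQi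
  have big : emb n (ex (-(2 * mA))) (ex mA • D2 a) *
      ((PA⁻¹ * PB) * emb n (ex (-(2 * mB))) (ex mB • D2 b) * (PB⁻¹ * PA)) *
      ((PA⁻¹ * PC) * emb n (ex (-(2 * mC))) (ex mC • D2 c) * (PC⁻¹ * PA)) = u • (1 : M3) := by
    calc _ = emb n (ex (-(2 * mA))) (ex mA • D2 a) * PA⁻¹ *
          (PB * emb n (ex (-(2 * mB))) (ex mB • D2 b) * PB⁻¹) *
          ((PA * PA⁻¹) * (PC * emb n (ex (-(2 * mC))) (ex mC • D2 c) * PC⁻¹)) * PA := by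
          simp only [Matrix.mul_assoc]
      _ = emb n (ex (-(2 * mA))) (ex mA • D2 a) * PA⁻¹ * B * C * PA := by
          rw [U_mul_inv hPA, Matrix.one_mul, ← hB, ← hC]
      _ = (PA⁻¹ * PA) * emb n (ex (-(2 * mA))) (ex mA • D2 a) * PA⁻¹ * B * C * PA := by
          rw [U_inv_mul hPA, Matrix.one_mul]
      _ = PA⁻¹ * (A * B * C) * PA := by
          rw [hA]; simp only [Matrix.mul_assoc]
      _ = u • (1 : M3) := by
          rw [hABC, Matrix.mul_smul, Matrix.mul_one, Matrix.smul_mul, U_inv_mul hPA]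
  rw [hRi, hQi, hR, hQ] at big
  simp only [emb_mul] at big
  rw [emb_smul_one n] at big
  obtain ⟨b1, b2⟩ := emb_inj big
  have u1 : u = ex (-(2 * (mA + mB + mC))) := by
    rw [← b1, show -(2 * (mA + mB + mC)) = -(2 * mA) + -(2 * mB) + -(2 * mC) by ring,
      ex_add, ex_add]
    linear_combination (ex (-(2 * mA)) * ex (-(2 * mB)) * ex (-(2 * mC))) *
      ((starRingEnd ℂ) (tA / tC) * (tA / tC) * r1 + q1)
  have u2 : ex (mA + mB + mC) • (D2 a * (R * D2 b * (J2 (sgn n) * Rᴴ * J2 (sgn n))) *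
      (Q * D2 c * (J2 (sgn n) * Qᴴ * J2 (sgn n)))) = u • (1 : M2) := by
    rw [← b2, ex_add, ex_add]
    simp only [Matrix.mul_smul, Matrix.smul_mul, smul_smul]
    congr 1; ring
  have sq : (u * ex (-(mA + mB + mC))) * (u * ex (-(mA + mB + mC))) = 1 := by
    have : ex (-(mA + mB + mC)) * ex (-(mA + mB + mC)) = u := by
      rw [← ex_add, u1]; congr 1; ring
    rw [← hu]
    linear_combination u ^ 2 * this
  have hε : ∃ ε : ℝ, ε * ε = 1 ∧ u * ex (-(mA + mB + mC)) = ε := by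
    rcases mul_self_eq_one_iff.mp sq with h | h
    · exact ⟨1, by norm_num, by simpa using h⟩
    · exact ⟨-1, by norm_num, by simpa using h⟩
  obtain ⟨ε, h1, h2⟩ := hε
  refine ⟨ε, h1, u1, ?_, ?_⟩
  · rw [← h2, mul_assoc, ex_neg_mul, mul_one]
  · refine cond_of_prod (sgn_sq n) r2 q2 ?_
    have := congrArg (fun T => ex (-(mA + mB + mC)) • T) u2
    simp only [smul_smul, ex_neg_mul, one_smul] at this
    rw [this, mul_comm, h2]

lemma common_ev_dual {W : Submodule ℂ (Fin 3 → ℂ)} {f : (Fin 3 → ℂ) →ₗ[ℂ] ℂ} (hf : f ≠ 0)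
    (hW : W = LinearMap.ker f) {M : M3} (hM : memU21 M) (h : ∀ w ∈ W, M.mulVec w ∈ W) :
    ∃ μ : ℂ, M.mulVec (J3.mulVec (star fun i => f (Pi.single i 1))) =
      μ • (J3.mulVec (star fun i => f (Pi.single i 1))) := by
  obtain ⟨w0, hw0⟩ : ∃ w0, f w0 ≠ 0 := by
    by_contra hcon
    push Not at hcon
    exact hf (LinearMap.ext hcon)
  have key : ∀ x, f (M.mulVec x) = (f (M.mulVec w0) / f w0) * f x := by
    intro x
    have h1 : x - (f x / f w0) • w0 ∈ W := by
      rw [hW, LinearMap.mem_ker, map_sub, map_smul, smul_eq_mul, div_mul_cancel₀ _ hw0, sub_self]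
    have h2 := h _ h1
    rw [hW, LinearMap.mem_ker, Matrix.mulVec_sub, Matrix.mulVec_smul, map_sub, map_smul,
      smul_eq_mul, sub_eq_zero] at h2
    rw [h2]; ring
  set μ := f (M.mulVec w0) / f w0
  set g : Fin 3 → ℂ := fun i => f (Pi.single i 1) with hg
  have fg : ∀ x, f x = g ⬝ᵥ x := by
    intro x
    conv_lhs => rw [← Matrix.one_mulVec x]
    rw [LinearMap.pi_apply_eq_sum_univ f]
    simp only [Matrix.one_mulVec, smul_eq_mul, dotProduct, hg]
    refine Finset.sum_congr rfl fun i _ => ?_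
    rw [mul_comm]
    congr 2
    ext j
    simp [Pi.single_apply, eq_comm]
  have row : g ᵥ* M = μ • g := by
    ext i
    have := key (Pi.single i 1)
    rw [fg, fg, Matrix.dotProduct_mulVec] at this
    simpa using this
  have col : Mᴴ.mulVec (star g) = (star μ) • star g := by
    rw [← Matrix.star_vecMul, row, star_smul]
  have inv : M⁻¹.mulVec (J3.mulVec (star g)) = (star μ) • J3.mulVec (star g) := by
    rw [U_inv hM, Matrix.mulVec_mulVec, Matrix.mul_assoc, J3_sq, Matrix.mul_one,
      ← Matrix.mulVec_mulVec, col, Matrix.mulVec_smul]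
  have e2 : J3.mulVec (star g) = (star μ) • M.mulVec (J3.mulVec (star g)) := by
    rw [← Matrix.mulVec_smul, ← inv, Matrix.mulVec_mulVec, U_mul_inv hM, Matrix.one_mulVec]
  by_cases h0 : star μ = 0
  · rw [h0, zero_smul] at e2
    exact ⟨0, by rw [e2]; simp⟩
  · refine ⟨(star μ)⁻¹, ?_⟩
    conv_rhs => rw [e2]
    rw [smul_smul, inv_mul_cancel₀ h0, one_smul]

lemma common_ev {W : Submodule ℂ (Fin 3 → ℂ)} (h0 : W ≠ ⊥) (h1 : W ≠ ⊤) :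
    ∃ v : Fin 3 → ℂ, v ≠ 0 ∧ ∀ M : M3, memU21 M → (∀ w ∈ W, M.mulVec w ∈ W) →
      ∃ μ : ℂ, M.mulVec v = μ • v := by
  have f3 : Module.finrank ℂ (Fin 3 → ℂ) = 3 := by simp
  have l3 : Module.finrank ℂ W < 3 := by
    have h := Submodule.finrank_lt h1
    rw [f3] at h
    exact h
  have g0 : 0 < Module.finrank ℂ W := by
    rw [Nat.pos_iff_ne_zero, Ne, Submodule.finrank_eq_zero]; exact h0
  by_cases h2 : Module.finrank ℂ W = 1
  · obtain ⟨⟨v, hv⟩, hv0, hsp⟩ := finrank_eq_one_iff'.mp h2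
    refine ⟨v, fun h => hv0 (by simp [h]), fun M _ hM => ?_⟩
    obtain ⟨c, hc⟩ := hsp ⟨M.mulVec v, hM v hv⟩
    exact ⟨c, by simpa using (congrArg Subtype.val hc).symm⟩
  · obtain ⟨f, hf, hle⟩ := Submodule.exists_le_ker_of_lt_top W (lt_top_iff_ne_top.mpr h1)
    have hker : W = LinearMap.ker f := by
      apply Submodule.eq_of_le_of_finrank_le hle
      have := LinearMap.finrank_range_add_finrank_ker f
      have hr : 0 < Module.finrank ℂ (LinearMap.range f) := by
        rw [Nat.pos_iff_ne_zero, Ne, Submodule.finrank_eq_zero, LinearMap.range_eq_bot]; exact hf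
      omega
    refine ⟨J3.mulVec (star fun i => f (Pi.single i 1)), ?_, fun M hU hM =>
      common_ev_dual hf hker hU hM⟩
    intro hz
    apply hf
    have hz2 := congrArg (fun v => J3.mulVec v) hz
    simp only [Matrix.mulVec_mulVec, J3_sq, Matrix.one_mulVec, Matrix.mulVec_zero] at hz2
    apply LinearMap.pi_ext'
    intro i
    ext
    have := congrFun hz2 i
    simpa using this

def qf (v : Fin 3 → ℂ) : ℝ := (star v ⬝ᵥ J3.mulVec v).re

lemma qf_U {P : M3} (hP : memU21 P) (w : Fin 3 → ℂ) : qf (P.mulVec w) = qf w := by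
  unfold qf
  rw [Matrix.star_mulVec, Matrix.dotProduct_mulVec, Matrix.vecMul_vecMul,
    Matrix.dotProduct_mulVec, Matrix.vecMul_vecMul, hP, Matrix.dotProduct_mulVec]

lemma qf_2 {t : ℂ} (ht : t ≠ 0) : qf (t • Pi.single 2 1) < 0 := by
  have := Complex.normSq_pos.mpr ht
  rw [Complex.normSq_apply] at this
  simp [qf, J3, Matrix.mulVec_diagonal, dotProduct, Fin.sum_univ_three]
  linarith

lemma qf_0 {t : ℂ} (ht : t ≠ 0) : 0 < qf (t • Pi.single 0 1) := by
  have := Complex.normSq_pos.mpr ht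
  rw [Complex.normSq_apply] at this
  simp [qf, J3, Matrix.mulVec_diagonal, dotProduct, Fin.sum_univ_three]
  linarith

lemma ex_ne_of {x y : ℝ} (h1 : y < x) (h2 : x < y + 2 * π) : ex x ≠ ex y := by
  rw [Ne, ex_eq_iff]
  rintro ⟨n, hn⟩
  have hπ := Real.pi_pos
  have a1 : (0 : ℝ) < n := by
    by_contra hc
    push Not at hc
    nlinarith
  have a2 : (n : ℝ) < 1 := by
    by_contra hc
    push Not at hc
    nlinarith
  have b1 : 0 < n := by exact_mod_cast a1
  have b2 : n < 1 := by exact_mod_cast a2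
  omega

lemma eigen {A : M3} {p : Pt} (hp : memTo p) (hA : Cj A p.1 p.2) {v : Fin 3 → ℂ} (hv : v ≠ 0)
    {μ : ℂ} (h : A.mulVec v = μ • v) :
    (qf v < 0 ∧ ∃ (P : M3) (t : ℂ), memU21 P ∧ A = P * Lmat p.1 p.2 * P⁻¹ ∧ t ≠ 0 ∧
      v = P.mulVec (t • Pi.single (rI true) 1)) ∨
    (0 < qf v ∧ ∃ (i : Fin 2) (P : M3) (t : ℂ), memU21 P ∧
      A = P * Lmat (coord p i) (coord p (i + 1)) * P⁻¹ ∧ t ≠ 0 ∧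
      v = P.mulVec (t • Pi.single (rI false) 1)) := by
  obtain ⟨P, hP, hAP⟩ := hA
  obtain ⟨h1, h2, h3⟩ := hp
  obtain ⟨w, hw⟩ : ∃ w, w = P⁻¹.mulVec v := ⟨_, rfl⟩
  have hvw : v = P.mulVec w := by
    rw [hw, Matrix.mulVec_mulVec, U_mul_inv hP, Matrix.one_mulVec]
  have hw0 : w ≠ 0 := by
    rintro rfl
    exact hv (by rw [hvw, Matrix.mulVec_zero])
  have hL : (Lmat p.1 p.2).mulVec w = μ • w := by
    have := congrArg (fun x => P⁻¹.mulVec x) h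
    rw [hAP, hvw] at this
    simp only [Matrix.mulVec_mulVec, Matrix.mulVec_smul] at this
    rw [show P⁻¹ * (P * Lmat p.1 p.2 * P⁻¹ * P) = (P⁻¹ * P) * Lmat p.1 p.2 * (P⁻¹ * P) by
      simp only [Matrix.mul_assoc], U_inv_mul hP, Matrix.one_mul, Matrix.mul_one,
      Matrix.one_mulVec] at this
    exact this
  have e : Lmat p.1 p.2 = Matrix.diagonal ![ex ((2 * p.1 - p.2) / 3), ex ((2 * p.2 - p.1) / 3),
      ex (-(p.1 + p.2) / 3)] := by
    simp [Lmat, ex]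
  have l0 : ex ((2 * p.1 - p.2) / 3) * w 0 = μ * w 0 := by
    have := congrFun hL 0
    rw [e, Matrix.mulVec_diagonal] at this
    simpa using this
  have l1 : ex ((2 * p.2 - p.1) / 3) * w 1 = μ * w 1 := by
    have := congrFun hL 1
    rw [e, Matrix.mulVec_diagonal] at this
    simpa using this
  have l2 : ex (-(p.1 + p.2) / 3) * w 2 = μ * w 2 := by
    have := congrFun hL 2
    rw [e, Matrix.mulVec_diagonal] at this
    simpa using this
  have d01 : ex ((2 * p.1 - p.2) / 3) ≠ ex ((2 * p.2 - p.1) / 3) :=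
    ex_ne_of (by linarith) (by linarith)
  have d02 : ex ((2 * p.1 - p.2) / 3) ≠ ex (-(p.1 + p.2) / 3) :=
    ex_ne_of (by linarith) (by linarith)
  have d12 : ex ((2 * p.2 - p.1) / 3) ≠ ex (-(p.1 + p.2) / 3) :=
    ex_ne_of (by linarith) (by linarith)
  have kill : ∀ (x y : ℂ) (i j : Fin 3), x * w i = μ * w i → y * w j = μ * w j → x ≠ y →
      w i ≠ 0 → w j = 0 := by
    intro x y i j hx hy hxy hi
    have hx' := mul_right_cancel₀ hi hx
    by_contra hj
    exact hxy (hx'.trans (mul_right_cancel₀ hj hy).symm)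
  by_cases c2 : w 2 = 0
  · right
    by_cases c0 : w 0 = 0
    · have c1 : w 1 ≠ 0 := by
        intro c1
        apply hw0
        ext i
        fin_cases i <;> simp [c0, c1, c2]
      have hs : Sw.mulVec w = w 1 • Pi.single 0 1 := by
        ext i
        fin_cases i <;> simp [Sw, c0, c2, Matrix.mulVec, dotProduct, Fin.sum_univ_three]
      have hv2 : v = (P * Sw).mulVec (w 1 • Pi.single 0 1) := by
        rw [← hs, Matrix.mulVec_mulVec, Matrix.mul_assoc, Sw_sq, Matrix.mul_one, hvw]
      refine ⟨?_, 1, P * Sw, w 1, U_mul hP Sw_mem, ?_, c1, hv2⟩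
      · rw [hv2, qf_U (U_mul hP Sw_mem)]; exact qf_0 c1
      · rw [hAP, Sw_L p.1 p.2, Matrix.mul_inv_rev]
        simp [coord, Matrix.mul_assoc]
    · have c1 := kill _ _ 0 1 l0 l1 d01 c0
      have hs : w = w 0 • Pi.single 0 1 := by
        ext i
        fin_cases i <;> simp [c1, c2]
      have hv2 : v = P.mulVec (w 0 • Pi.single 0 1) := by rw [← hs, hvw]
      refine ⟨?_, 0, P, w 0, hP, ?_, c0, hv2⟩
      · rw [hv2, qf_U hP]; exact qf_0 c0
      · rw [hAP]; simp [coord]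
  · left
    have c0 := kill _ _ 2 0 l2 l0 d02.symm c2
    have c1 := kill _ _ 2 1 l2 l1 d12.symm c2
    have hs : w = w 2 • Pi.single 2 1 := by
      ext i
      fin_cases i <;> simp [c1, c0]
    have hv2 : v = P.mulVec (w 2 • Pi.single 2 1) := by rw [← hs, hvw]
    refine ⟨?_, P, w 2, hP, hAP, c2, hv2⟩
    rw [hv2, qf_U hP]; exact qf_2 c2

lemma emb_ev (n : Bool) (t : ℂ) (M : M2) :
    (emb n t M).mulVec (Pi.single (rI n) 1) = t • Pi.single (rI n) 1 := by
  cases n <;> ext i <;> fin_cases i <;> simp [emb, rI]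

lemma backward {n : Bool} {u : ℂ} {ε mA mB mC a b c : ℝ} (hε : ε * ε = 1)
    (sb : 0 < sin b) (sc : 0 < sin c)
    (u1 : u = ex (-(2 * (mA + mB + mC)))) (u2 : u = ε * ex (mA + mB + mC))
    (h : CondR (sgn n) ε a b c) : ∃ A B C : M3,
    (∃ P, memU21 P ∧ A = P * emb n (ex (-(2 * mA))) (ex mA • D2 a) * P⁻¹) ∧
    (∃ P, memU21 P ∧ B = P * emb n (ex (-(2 * mB))) (ex mB • D2 b) * P⁻¹) ∧
    (∃ P, memU21 P ∧ C = P * emb n (ex (-(2 * mC))) (ex mC • D2 c) * P⁻¹) ∧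
    A * B * C = u • (1 : M3) ∧
    ∃ W : Submodule ℂ (Fin 3 → ℂ), W ≠ ⊥ ∧ W ≠ ⊤ ∧
    (∀ w ∈ W, A.mulVec w ∈ W) ∧ (∀ w ∈ W, B.mulVec w ∈ W) ∧ (∀ w ∈ W, C.mulVec w ∈ W) := by
  obtain ⟨R, Q, R', Q', hR, hQ, hRR, hQQ, hprod⟩ := prod_of_cond (sgn_sq n) hε sb sc h
  have inv : ∀ T T' : M2, T * T' = 1 → (emb n 1 T)⁻¹ = emb n 1 T' := by
    intro T T' hT
    apply Matrix.inv_eq_right_inv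
    rw [emb_mul, hT, mul_one, emb_one]
  have stab : ∀ (t : ℂ) (M : M2), ∀ w ∈ Submodule.span ℂ {(Pi.single (rI n) 1 : Fin 3 → ℂ)},
      (emb n t M).mulVec w ∈ Submodule.span ℂ {(Pi.single (rI n) 1 : Fin 3 → ℂ)} := by
    intro t M w hw
    obtain ⟨k, rfl⟩ := Submodule.mem_span_singleton.mp hw
    rw [Matrix.mulVec_smul, emb_ev]
    exact Submodule.smul_mem _ _ (Submodule.smul_mem _ _ (Submodule.mem_span_singleton_self _))
  refine ⟨emb n (ex (-(2 * mA))) (ex mA • D2 a),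
    emb n (ex (-(2 * mB))) (R * (ex mB • D2 b) * R'),
    emb n (ex (-(2 * mC))) (Q * (ex mC • D2 c) * Q'),
    ⟨1, U_one, by simp⟩, ⟨emb n 1 R, (emb_mem_iff _ _ _).mpr ⟨by simp, hR⟩, ?_⟩,
    ⟨emb n 1 Q, (emb_mem_iff _ _ _).mpr ⟨by simp, hQ⟩, ?_⟩, ?_,
    Submodule.span ℂ {Pi.single (rI n) 1}, ?_, ?_, stab _ _, stab _ _, stab _ _⟩
  · rw [inv _ _ hRR, emb_mul, emb_mul, one_mul, mul_one]
  · rw [inv _ _ hQQ, emb_mul, emb_mul, one_mul, mul_one]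
  · rw [emb_mul, emb_mul, emb_smul_one n]
    congr 1
    · rw [u1, ← ex_add, ← ex_add]; congr 1; ring
    · simp only [Matrix.mul_smul, Matrix.smul_mul, smul_smul]
      rw [hprod, smul_smul, u2, ex_add, ex_add]
      congr 1; ring
  · rw [Ne, Submodule.span_singleton_eq_bot]
    intro h0
    have := congrFun h0 (rI n)
    simp at this
  · intro ht
    have h1 := finrank_span_le_card (R := ℂ) ({Pi.single (rI n) 1} : Set (Fin 3 → ℂ))
    rw [ht, finrank_top] at h1
    simp at h1

lemma coord_pos {p : Pt} (hp : memTo p) (i : Fin 2) : 0 < coord p i ∧ coord p i < 2 * π := by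
  obtain ⟨h1, h2, h3⟩ := hp
  fin_cases i <;> simp [coord] <;> constructor <;> linarith

lemma memT_of {p : Pt} (hp : memTo p) : memT p := by
  obtain ⟨h1, h2, h3⟩ := hp
  refine ⟨?_, ?_, ?_, ?_, ?_⟩ <;> linarith

theorem char_red {u : ℂ} (hu : u ^ 3 = 1) {τ : Tri} (hτ : memTo3 τ) : τ ∈ PsolRed u ↔
    (∃ ε : ℝ, ε * ε = 1 ∧ u = ex (-(2 * (Sf τ / 6))) ∧ u = ε * ex (Sf τ / 6) ∧
      CondR 1 ε ((τ.1.1 - τ.1.2) / 2) ((τ.2.1.1 - τ.2.1.2) / 2) ((τ.2.2.1 - τ.2.2.2) / 2)) ∨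
    (∃ i j k : Fin 2, ∃ ε : ℝ, ε * ε = 1 ∧ u = ex (-(2 * (-Hf τ i j k / 6))) ∧
      u = ε * ex (-Hf τ i j k / 6) ∧
      CondR (-1) ε (coord τ.1 (i + 1) / 2) (coord τ.2.1 (j + 1) / 2) (coord τ.2.2 (k + 1) / 2)) := by
  obtain ⟨hα, hβ, hγ⟩ := hτ
  have eS : Sf τ / 6 = (τ.1.1 + τ.1.2) / 6 + (τ.2.1.1 + τ.2.1.2) / 6 + (τ.2.2.1 + τ.2.2.2) / 6 := by
    unfold Sf; ring
  have eH : ∀ i j k, -Hf τ i j k / 6 = (coord τ.1 (i + 1) - 2 * coord τ.1 i) / 6 +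
      (coord τ.2.1 (j + 1) - 2 * coord τ.2.1 j) / 6 +
      (coord τ.2.2 (k + 1) - 2 * coord τ.2.2 k) / 6 := by
    intro i j k; unfold Hf sg; ring
  have s1 : (1 : ℝ) = sgn true := by simp [sgn]
  have s2 : (-1 : ℝ) = sgn false := by simp [sgn]
  constructor
  · rintro ⟨-, A, B, C, mA, mB, mC, hA, hB, hC, hABC, W, hW0, hW1, wA, wB, wC⟩
    obtain ⟨v, hv, hev⟩ := common_ev hW0 hW1
    obtain ⟨μA, eA⟩ := hev A mA wA
    obtain ⟨μB, eB⟩ := hev B mB wB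
    obtain ⟨μC, eC⟩ := hev C mC wC
    have kA := eigen hα hA hv eA
    have kB := eigen hβ hB hv eB
    have kC := eigen hγ hC hv eC
    rcases lt_or_ge (qf v) 0 with hq | hq
    · left
      have kA' := kA.resolve_right (fun h => lt_asymm h.1 hq)
      have kB' := kB.resolve_right (fun h => lt_asymm h.1 hq)
      have kC' := kC.resolve_right (fun h => lt_asymm h.1 hq)
      clear kA kB kC
      obtain ⟨-, PA, tA, hPA, dA, hA0, vA⟩ := kA'
      obtain ⟨-, PB, tB, hPB, dB, hB0, vB⟩ := kB'
      obtain ⟨-, PC, tC, hPC, dC, hC0, vC⟩ := kC'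
      rw [Lmat_N] at dA dB dC
      rw [eS, s1]
      exact forward hu hPA hPB hPC dA dB dC hABC hA0 hB0 hC0 vA vB vC
    · right
      have kA' := kA.resolve_left (fun h => not_lt.mpr hq h.1)
      have kB' := kB.resolve_left (fun h => not_lt.mpr hq h.1)
      have kC' := kC.resolve_left (fun h => not_lt.mpr hq h.1)
      clear kA kB kC
      obtain ⟨-, i, PA, tA, hPA, dA, hA0, vA⟩ := kA'
      obtain ⟨-, j, PB, tB, hPB, dB, hB0, vB⟩ := kB'
      obtain ⟨-, k, PC, tC, hPC, dC, hC0, vC⟩ := kC'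
      rw [Lmat_P] at dA dB dC
      refine ⟨i, j, k, ?_⟩
      rw [eH, s2]
      exact forward hu hPA hPB hPC dA dB dC hABC hA0 hB0 hC0 vA vB vC
  · intro h
    have fin : (∃ (i j k : Fin 2) (A B C : M3), Cj A (coord τ.1 i) (coord τ.1 (i + 1)) ∧
        Cj B (coord τ.2.1 j) (coord τ.2.1 (j + 1)) ∧ Cj C (coord τ.2.2 k) (coord τ.2.2 (k + 1)) ∧
        A * B * C = u • (1 : M3) ∧
        ∃ W : Submodule ℂ (Fin 3 → ℂ), W ≠ ⊥ ∧ W ≠ ⊤ ∧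
        (∀ w ∈ W, A.mulVec w ∈ W) ∧ (∀ w ∈ W, B.mulVec w ∈ W) ∧ (∀ w ∈ W, C.mulVec w ∈ W)) →
        τ ∈ PsolRed u := by
      rintro ⟨i, j, k, A, B, C, hA, hB, hC, hr⟩
      rw [Cj_coord] at hA hB hC
      exact ⟨⟨memT_of hα, memT_of hβ, memT_of hγ⟩, A, B, C, Cj_mem hA, Cj_mem hB, Cj_mem hC,
        hA, hB, hC, hr⟩
    apply fin
    have hπ := Real.pi_pos
    rcases h with ⟨ε, hε, u1, u2, hc⟩ | ⟨i, j, k, ε, hε, u1, u2, hc⟩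
    · rw [eS] at u1 u2
      rw [s1] at hc
      have q1 := hβ.1
      have q2 := hβ.2.1
      have q3 := hβ.2.2
      have r1 := hγ.1
      have r2 := hγ.2.1
      have r3 := hγ.2.2
      have := backward hε (Real.sin_pos_of_pos_of_lt_pi (by linarith) (by linarith))
        (Real.sin_pos_of_pos_of_lt_pi (by linarith) (by linarith)) u1 u2 hc
      simp only [← Lmat_N] at this
      obtain ⟨A, B, C, hh⟩ := this
      exact ⟨0, 0, 0, A, B, C, by simpa [Cj, coord] using hh⟩
    · rw [eH] at u1 u2
      rw [s2] at hc
      have q1 := coord_pos hβ (j + 1)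
      have r1 := coord_pos hγ (k + 1)
      have := backward hε (Real.sin_pos_of_pos_of_lt_pi (by linarith) (by linarith))
        (Real.sin_pos_of_pos_of_lt_pi (by linarith) (by linarith)) u1 u2 hc
      simp only [← Lmat_P] at this
      obtain ⟨A, B, C, hh⟩ := this
      exact ⟨i, j, k, A, B, C, hh⟩

lemma fin_two_add : (1 : Fin 2) + 1 = 0 := rfl

lemma neg_one_ex (M : ℝ) : -ex M = ex (M + π) := by
  rw [ex_add]
  have : ex π = -1 := by simp [ex]
  rw [this]; ring

lemma eps_form (n : ℤ) (M : ℝ) (C : ℝ → Prop) :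
    (∃ ε : ℝ, ε * ε = 1 ∧ ex (2 * π * n / 3) = ex (-(2 * M)) ∧
      ex (2 * π * n / 3) = ε * ex M ∧ C ε) ↔
    (∃ m : ℤ, 6 * M = (4 * n - 12 * m : ℤ) * π ∧ C 1) ∨
    (∃ m : ℤ, 6 * M = (4 * n - 12 * m - 6 : ℤ) * π ∧ C (-1)) := by
  constructor
  · rintro ⟨ε, hε, -, h2, hC⟩
    rcases mul_self_eq_one_iff.mp hε with rfl | rfl
    · left
      rw [Complex.ofReal_one, one_mul, ex_eq_iff] at h2
      obtain ⟨m, hm⟩ := h2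
      refine ⟨m, ?_, hC⟩
      push_cast
      linarith
    · right
      rw [Complex.ofReal_neg, Complex.ofReal_one, neg_one_mul, neg_one_ex, ex_eq_iff] at h2
      obtain ⟨m, hm⟩ := h2
      refine ⟨m, ?_, hC⟩
      push_cast
      linarith
  · rintro (⟨m, hm, hC⟩ | ⟨m, hm, hC⟩)
    · push_cast at hm
      refine ⟨1, by norm_num, ?_, ?_, hC⟩
      · rw [ex_eq_iff]
        refine ⟨n - 2 * m, ?_⟩
        push_cast
        linarith
      · rw [Complex.ofReal_one, one_mul, ex_eq_iff]
        exact ⟨m, by linarith⟩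
    · push_cast at hm
      refine ⟨-1, by norm_num, ?_, ?_, hC⟩
      · rw [ex_eq_iff]
        refine ⟨n - 2 * m - 1, ?_⟩
        push_cast
        linarith
      · rw [Complex.ofReal_neg, Complex.ofReal_one, neg_one_mul, neg_one_ex, ex_eq_iff]
        exact ⟨m, by linarith⟩

lemma sig_bounds {p : Pt} (hp : memTo p) : 0 < (p.1 - p.2) / 2 ∧ (p.1 - p.2) / 2 < π := by
  obtain ⟨h1, h2, h3⟩ := hp
  constructor <;> linarith

lemma half_bounds {p : Pt} (hp : memTo p) (i : Fin 2) :
    0 < coord p i / 2 ∧ coord p i / 2 < π := by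
  have := coord_pos hp i
  constructor <;> linarith

/-- Arithmetic form of the characterization of reducible solutions. -/
theorem char_arith (n : ℤ) {τ : Tri} (hτ : memTo3 τ) : τ ∈ PsolRed (ex (2 * π * n / 3)) ↔
    ((∃ m : ℤ, Sf τ = (4 * n - 12 * m : ℤ) * π ∧ sg τ 0 1 1 ≤ sg τ 1 0 0 ∧
        sg τ 1 0 1 ≤ sg τ 0 1 0 ∧ sg τ 1 1 0 ≤ sg τ 0 0 1 ∧ sg τ 0 0 0 - sg τ 1 1 1 ≤ 4 * π) ∨
      (∃ m : ℤ, Sf τ = (4 * n - 12 * m - 6 : ℤ) * π ∧ 2 * π ≤ sg τ 0 0 0 - sg τ 1 1 1 ∧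
        sg τ 0 0 1 - sg τ 1 1 0 ≤ 2 * π ∧ sg τ 0 1 0 - sg τ 1 0 1 ≤ 2 * π ∧
        sg τ 1 0 0 - sg τ 0 1 1 ≤ 2 * π)) ∨
    ∃ i j k : Fin 2,
      (∃ m : ℤ, Hf τ i j k = (12 * m - 4 * n : ℤ) * π ∧
        4 * π ≤ sg τ (i + 1) (j + 1) (k + 1)) ∨
      (∃ m : ℤ, Hf τ i j k = (12 * m + 6 - 4 * n : ℤ) * π ∧
        sg τ (i + 1) (j + 1) (k + 1) ≤ 2 * π) := by
  have hu : ex (2 * π * n / 3) ^ 3 = 1 := by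
    have : ex (2 * π * n / 3) ^ 3 = ex (2 * π * n / 3 + 2 * π * n / 3 + 2 * π * n / 3) := by
      rw [ex_add, ex_add]; ring
    rw [this, ← ex_zero, ex_eq_iff]
    exact ⟨n, by ring⟩
  rw [char_red hu hτ, eps_form]
  obtain ⟨hα, hβ, hγ⟩ := hτ
  have a := sig_bounds hα
  have b := sig_bounds hβ
  have c := sig_bounds hγ
  refine or_congr (or_congr ?_ ?_) ?_
  · refine exists_congr fun m => and_congr ?_ ?_
    · rw [mul_div_cancel₀]; norm_num
    · rw [sph_pos a.1 a.2 b.1 b.2 c.1 c.2]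
      simp only [sg, coord]
      norm_num
      refine and_congr ?_ (and_congr ?_ (and_congr ?_ ?_)) <;> constructor <;> intro h <;> linarith
  · refine exists_congr fun m => and_congr ?_ ?_
    · rw [mul_div_cancel₀]; norm_num
    · rw [sph_neg a.1 a.2 b.1 b.2 c.1 c.2]
      simp only [sg, coord]
      norm_num
      refine and_congr ?_ (and_congr ?_ (and_congr ?_ ?_)) <;> constructor <;> intro h <;> linarith
  · refine exists_congr fun i => exists_congr fun j => exists_congr fun k => ?_
    have a := half_bounds hα (i + 1)
    have b := half_bounds hβ (j + 1)
    have c := half_bounds hγ (k + 1)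
    rw [eps_form, hyp_pos a.1 a.2 b.1 b.2 c.1 c.2, hyp_neg a.1 a.2 b.1 b.2 c.1 c.2]
    refine or_congr ?_ ?_
    · refine exists_congr fun m => and_congr ?_ ?_
      · push_cast
        constructor <;> intro h <;> linarith
      · unfold sg
        constructor <;> intro h <;> linarith
    · refine exists_congr fun m => and_congr ?_ ?_
      · push_cast
        constructor <;> intro h <;> linarith
      · unfold sg
        constructor <;> intro h <;> linarith

lemma int_lt_of {a b : ℤ} (h : (a : ℝ) * π < b * π) : a < b := by
  have := lt_of_mul_lt_mul_right h Real.pi_pos.le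
  exact_mod_cast this

lemma Sf_bounds {τ : Tri} (hτ : memTo3 τ) {z : ℤ} (h : Sf τ = z * π) : 0 < z ∧ z < 12 := by
  obtain ⟨⟨a1, a2, a3⟩, ⟨b1, b2, b3⟩, ⟨c1, c2, c3⟩⟩ := hτ
  unfold Sf at h
  constructor
  · apply int_lt_of; push_cast; linarith
  · apply int_lt_of; push_cast; linarith

lemma Hf_bounds {τ : Tri} (hτ : memTo3 τ) {i j k : Fin 2} {z : ℤ} (h : Hf τ i j k = z * π) :
    -6 < z ∧ z < 12 := by
  obtain ⟨hα, hβ, hγ⟩ := hτ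
  have a := coord_pos hα i
  have b := coord_pos hβ j
  have c := coord_pos hγ k
  have a1 := coord_pos hα (i + 1)
  have b1 := coord_pos hβ (j + 1)
  have c1 := coord_pos hγ (k + 1)
  unfold Hf sg at h
  constructor
  · apply int_lt_of; push_cast; linarith
  · apply int_lt_of; push_cast; linarith

lemma memT3_of {τ : Tri} (hτ : memTo3 τ) : memT3 τ :=
  ⟨memT_of hτ.1, memT_of hτ.2.1, memT_of hτ.2.2⟩

lemma layer4 {τ : Tri} (hτ : memTo3 τ) : τ ∈ PsolRed (ex (2 * π * (1 : ℤ) / 3)) ↔ τ ∈ P4red := by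
  have hm := memT3_of hτ
  have hπ := Real.pi_pos
  rw [char_arith 1 hτ]
  have hτ' := hτ
  obtain ⟨⟨a1, a2, a3⟩, ⟨b1, b2, b3⟩, ⟨c1, c2, c3⟩⟩ := hτ'
  constructor
  · rintro ((⟨m, h, q1, q2, q3, q4⟩ | ⟨m, h, q1, q2, q3, q4⟩) | ⟨i, j, k, ⟨m, h, q⟩ | ⟨m, h, q⟩⟩)
    · have := Sf_bounds hτ h
      obtain rfl : m = 0 := by omega
      refine ⟨hm, Or.inl ⟨hm, ?_⟩⟩
      norm_num at h
      norm_num [Sf, sg, coord] at h q1 q2 q3 q4 ⊢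
      refine ⟨h, ?_, ?_, ?_, ?_⟩ <;> linarith
    · exfalso
      have := Sf_bounds hτ h
      obtain rfl : m = -1 := by omega
      norm_num at h
      norm_num [Sf, sg, coord] at h q1 q2 q3 q4
      linarith
    · have := Hf_bounds hτ h
      obtain rfl | rfl : m = 0 ∨ m = 1 := by omega
      · refine ⟨hm, Or.inr (Or.inl ?_)⟩
        norm_num at h
        fin_cases i <;> fin_cases j <;> fin_cases k <;>
          norm_num [Hf, sg, coord, fin_two_add] at h q ⊢ <;> linarith
      · exfalso
        norm_num at h
        fin_cases i <;> fin_cases j <;> fin_cases k <;>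
          norm_num [Hf, sg, coord, fin_two_add] at h q <;> linarith
    · have := Hf_bounds hτ h
      obtain rfl : m = 0 := by omega
      refine ⟨hm, Or.inr (Or.inr ⟨i, j, k, ?_, ?_, q⟩)⟩
      · rintro ⟨rfl, rfl, rfl⟩
        norm_num at h
        norm_num [Hf, sg, coord, fin_two_add] at h q
        linarith
      · norm_num at h
        exact h
  · rintro ⟨-, ⟨-, h, q1, q2, q3, q4⟩ | h | ⟨i, j, k, -, h, q⟩⟩
    · left; left
      refine ⟨0, ?_, ?_⟩
      · norm_num; exact h
      · norm_num [Sf, sg, coord] at h q1 q2 q3 q4 ⊢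
        refine ⟨?_, ?_, ?_, ?_⟩ <;> linarith
    · right
      refine ⟨1, 1, 1, Or.inl ⟨0, ?_, ?_⟩⟩
      · norm_num; linarith
      · norm_num [Hf, sg, coord, fin_two_add] at h ⊢
        linarith
    · right
      refine ⟨i, j, k, Or.inr ⟨0, ?_, q⟩⟩
      norm_num; exact h

lemma layer6 {τ : Tri} (hτ : memTo3 τ) : τ ∈ PsolRed (ex (2 * π * (0 : ℤ) / 3)) ↔ τ ∈ P6red := by
  have hm := memT3_of hτ
  have hπ := Real.pi_pos
  rw [char_arith 0 hτ]
  have hτ' := hτ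
  obtain ⟨⟨a1, a2, a3⟩, ⟨b1, b2, b3⟩, ⟨c1, c2, c3⟩⟩ := hτ'
  constructor
  · rintro ((⟨m, h, q1, q2, q3, q4⟩ | ⟨m, h, q1, q2, q3, q4⟩) | ⟨i, j, k, ⟨m, h, q⟩ | ⟨m, h, q⟩⟩)
    · have := Sf_bounds hτ h
      omega
    · have := Sf_bounds hτ h
      obtain rfl : m = -1 := by omega
      refine ⟨hm, Or.inl ⟨hm, ?_⟩⟩
      norm_num at h
      norm_num [Sf, sg, coord] at h q1 q2 q3 q4 ⊢
      refine ⟨h, ?_, ?_, ?_, ?_⟩ <;> linarith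
    · have := Hf_bounds hτ h
      obtain rfl : m = 0 := by omega
      norm_num at h
      refine ⟨hm, Or.inr (Or.inl ⟨i, j, k, ?_, h, q⟩)⟩
      fin_cases i <;> fin_cases j <;> fin_cases k <;>
        first
          | (exfalso; norm_num [Hf, sg, coord, fin_two_add] at h q; linarith)
          | simp
    · have := Hf_bounds hτ h
      obtain rfl : m = 0 := by omega
      norm_num at h
      refine ⟨hm, Or.inr (Or.inr ⟨i, j, k, ?_, h, q⟩)⟩
      fin_cases i <;> fin_cases j <;> fin_cases k <;>
        first
          | (exfalso; norm_num [Hf, sg, coord, fin_two_add] at h q; linarith)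
          | simp
  · rintro ⟨-, ⟨-, h, q1, q2, q3, q4⟩ | ⟨i, j, k, -, h, q⟩ | ⟨i, j, k, -, h, q⟩⟩
    · left; right
      refine ⟨-1, ?_, ?_⟩
      · norm_num; exact h
      · norm_num [Sf, sg, coord] at h q1 q2 q3 q4 ⊢
        refine ⟨?_, ?_, ?_, ?_⟩ <;> linarith
    · right
      refine ⟨i, j, k, Or.inl ⟨0, ?_, q⟩⟩
      norm_num; exact h
    · right
      refine ⟨i, j, k, Or.inr ⟨0, ?_, q⟩⟩
      norm_num; exact h

lemma layer8 {τ : Tri} (hτ : memTo3 τ) : τ ∈ PsolRed (ex (2 * π * (2 : ℤ) / 3)) ↔ τ ∈ P8red := by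
  have hm := memT3_of hτ
  have hπ := Real.pi_pos
  rw [char_arith 2 hτ]
  have hτ' := hτ
  obtain ⟨⟨a1, a2, a3⟩, ⟨b1, b2, b3⟩, ⟨c1, c2, c3⟩⟩ := hτ'
  constructor
  · rintro ((⟨m, h, q1, q2, q3, q4⟩ | ⟨m, h, q1, q2, q3, q4⟩) | ⟨i, j, k, ⟨m, h, q⟩ | ⟨m, h, q⟩⟩)
    · have := Sf_bounds hτ h
      obtain rfl : m = 0 := by omega
      refine ⟨hm, Or.inl ⟨hm, ?_⟩⟩
      norm_num at h
      norm_num [Sf, sg, coord] at h q1 q2 q3 q4 ⊢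
      refine ⟨h, ?_, ?_, ?_, ?_⟩ <;> linarith
    · exfalso
      have := Sf_bounds hτ h
      obtain rfl : m = 0 := by omega
      norm_num at h
      norm_num [Sf, sg, coord] at h q1 q2 q3 q4
      linarith
    · have := Hf_bounds hτ h
      obtain rfl : m = 1 := by omega
      refine ⟨hm, Or.inr (Or.inr ⟨i, j, k, ?_, ?_, q⟩)⟩
      · rintro ⟨rfl, rfl, rfl⟩
        norm_num at h
        norm_num [Hf, sg, coord, fin_two_add] at h q
        linarith
      · norm_num at h
        exact h
    · have := Hf_bounds hτ h
      obtain rfl | rfl : m = 0 ∨ m = 1 := by omega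
      · exfalso
        norm_num at h
        fin_cases i <;> fin_cases j <;> fin_cases k <;>
          norm_num [Hf, sg, coord, fin_two_add] at h q <;> linarith
      · refine ⟨hm, Or.inr (Or.inl ?_)⟩
        norm_num at h
        fin_cases i <;> fin_cases j <;> fin_cases k <;>
          norm_num [Hf, sg, coord, fin_two_add] at h q ⊢ <;> linarith
  · rintro ⟨-, ⟨-, h, q1, q2, q3, q4⟩ | h | ⟨i, j, k, -, h, q⟩⟩
    · left; left
      refine ⟨0, ?_, ?_⟩
      · norm_num; exact h
      · norm_num [Sf, sg, coord] at h q1 q2 q3 q4 ⊢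
        refine ⟨?_, ?_, ?_, ?_⟩ <;> linarith
    · right
      refine ⟨0, 0, 0, Or.inr ⟨1, ?_, ?_⟩⟩
      · norm_num; linarith
      · norm_num [Hf, sg, coord, fin_two_add] at h ⊢
        linarith
    · right
      refine ⟨i, j, k, Or.inl ⟨1, ?_, q⟩⟩
      norm_num; exact h

lemma omg_eq : omg = ex (2 * π * (1 : ℤ) / 3) := by
  unfold omg ex
  congr 1
  push_cast
  ring

lemma omg_sq_eq : omg ^ 2 = ex (2 * π * (2 : ℤ) / 3) := by
  rw [omg_eq, sq, ← ex_add]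
  congr 1
  push_cast
  ring

lemma one_eq_ex : (1 : ℂ) = ex (2 * π * (0 : ℤ) / 3) := by simp [ex_zero]

/-- Layers of the reducible walls. -/
theorem reducible_wall_layers :
    PsolRed omg ∩ {τ : Tri | memTo3 τ} = P4red ∩ {τ : Tri | memTo3 τ} ∧
    PsolRed 1 ∩ {τ : Tri | memTo3 τ} = P6red ∩ {τ : Tri | memTo3 τ} ∧
    PsolRed (omg ^ 2) ∩ {τ : Tri | memTo3 τ} = P8red ∩ {τ : Tri | memTo3 τ} := by
  rw [omg_sq_eq, omg_eq, one_eq_ex]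
  refine ⟨?_, ?_, ?_⟩
  · ext τ
    exact and_congr_left fun h => layer4 h
  · ext τ
    exact and_congr_left fun h => layer6 h
  · ext τ
    exact and_congr_left fun h => layer8 h
end
end
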